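/- arXiv:2209.11728 — 8 statements merged into one kernel-verified Lean document; each statement's English description precedes it below -/
import Mathlib

section
/- In the discrete Bayesian setup, for every θ₀ ∈ Θ, the law of the posterior q^{θ₀} under P_{θ₀} likelihood-ratio dominates the law of q^{θ₀} under the marginal P; that is, for all real numbers t < t', (∑_{s : q^{θ₀}(s)=t'} P_{θ₀}(s)) · (∑_{s : q^{θ₀}(s)=t} P(s)) ≥ (∑_{s : q^{θ₀}(s)=t} P_{θ₀}(s)) · (∑_{s : q^{θ₀}(s)=t'} P(s)). -/
open Finset
open scoped Classical

/-- Bayes' rule aggregated over a level set of the posterior: if `a s * c = q s * b s` pointwise,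
then on `{q = t}` the total mass of `a` is `t / c` times that of `b`. -/
theorem sum_level_set_mul_eq {S : Type*} [Fintype S] (a b q : S → ℝ) (c : ℝ)
    (h : ∀ s, a s * c = q s * b s) (t : ℝ) :
    (∑ s ∈ univ.filter (fun s => q s = t), a s) * c =
      t * ∑ s ∈ univ.filter (fun s => q s = t), b s := by
  rw [Finset.sum_mul, Finset.mul_sum]
  refine Finset.sum_congr rfl fun s hs => ?_
  rw [h s, (Finset.mem_filter.mp hs).2]

/-- In the discrete Bayesian setup (finite parameter set `Θ`, finite signal
set `S`, prior `π` positive and summing to `1`, conditional pmfs `P θ`, marginal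
`Pm s = ∑ θ, π θ * P θ s`, posterior `q s = P θ₀ s * π θ₀ / Pm s` when `Pm s > 0` and `0`
otherwise), the law of the posterior `q^{θ₀}` under `P_{θ₀}` likelihood-ratio dominates its
law under the marginal `P`. -/
theorem posterior_lr_dominance
    {Θ S : Type*} [Fintype Θ] [Fintype S]
    (π : Θ → ℝ) (hπpos : ∀ θ, 0 < π θ) (hπsum : ∑ θ, π θ = 1)
    (P : Θ → S → ℝ)
    (hPnonneg : ∀ θ s, 0 ≤ P θ s) (hPsum : ∀ θ, ∑ s, P θ s = 1)
    (Pm : S → ℝ) (hPm : ∀ s, Pm s = ∑ θ, π θ * P θ s)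
    (θ₀ : Θ)
    (q : S → ℝ)
    (hq : ∀ s, q s = if 0 < Pm s then P θ₀ s * π θ₀ / Pm s else 0)
    (t t' : ℝ) (htt' : t < t') :
    (∑ s ∈ univ.filter (fun s => q s = t'), P θ₀ s) *
        (∑ s ∈ univ.filter (fun s => q s = t), Pm s) ≥
      (∑ s ∈ univ.filter (fun s => q s = t), P θ₀ s) *
        (∑ s ∈ univ.filter (fun s => q s = t'), Pm s) := by
  have hPm_nonneg : ∀ s, 0 ≤ Pm s := fun s => by
    rw [hPm s]
    exact Finset.sum_nonneg fun θ _ => mul_nonneg (hπpos θ).le (hPnonneg θ s)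
  have bayes : ∀ s, P θ₀ s * π θ₀ = q s * Pm s := fun s => by
    rw [hq s]
    split_ifs with hs
    · rw [div_mul_cancel₀ _ hs.ne']
    · have hle : π θ₀ * P θ₀ s ≤ Pm s := by
        rw [hPm s]
        exact Finset.single_le_sum (f := fun θ => π θ * P θ s)
          (fun θ _ => mul_nonneg (hπpos θ).le (hPnonneg θ s)) (Finset.mem_univ θ₀)
      have := mul_nonneg (hπpos θ₀).le (hPnonneg θ₀ s)
      linarith
  have ht := sum_level_set_mul_eq (P θ₀) Pm q (π θ₀) bayes t
  have ht' := sum_level_set_mul_eq (P θ₀) Pm q (π θ₀) bayes t'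
  have hB : 0 ≤ ∑ s ∈ univ.filter (fun s => q s = t), Pm s :=
    Finset.sum_nonneg fun s _ => hPm_nonneg s
  have hB' : 0 ≤ ∑ s ∈ univ.filter (fun s => q s = t'), Pm s :=
    Finset.sum_nonneg fun s _ => hPm_nonneg s
  generalize (∑ s ∈ univ.filter (fun s => q s = t), Pm s) = B at *
  generalize (∑ s ∈ univ.filter (fun s => q s = t'), Pm s) = B' at *
  refine le_of_mul_le_mul_right ?_ (hπpos θ₀)
  rw [mul_right_comm, ht, mul_right_comm _ B (π θ₀), ht']
  nlinarith [mul_nonneg (sub_nonneg.mpr htt'.le) (mul_nonneg hB hB')]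
end

section
/- In the discrete Bayesian setup, assume Θ ⊂ ℝ and S ⊂ ℝ are finite sets, let θ₀ = min Θ and θ₁ = max Θ, and assume the family (P_θ) has the monotone likelihood ratio property: for all θ < θ' in Θ and all s < s' in S, P_{θ'}(s') · P_θ(s) ≥ P_{θ'}(s) · P_θ(s'). Then the law of the posterior q^{θ₀} under P_{θ₀} likelihood-ratio dominates the law of q^{θ₀} under the marginal P, which in turn likelihood-ratio dominates the law of q^{θ₀} under P_{θ₁}. -/
open Finset
open scoped Classical

/-- Discrete Bayesian setup with `Θ ⊂ ℝ` and `S ⊂ ℝ` finite, `θ₀ = min Θ`,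
`θ₁ = max Θ`, and the family `(P θ)` having the monotone likelihood ratio property.  Then the
law of the posterior `q^{θ₀}` under `P_{θ₀}` likelihood-ratio dominates its law under the
marginal `P`, which in turn likelihood-ratio dominates its law under `P_{θ₁}`. -/
theorem posterior_lr_dominance_mlrp
    (Θ S : Finset ℝ) (hΘne : Θ.Nonempty) (hSne : S.Nonempty)
    (π : ℝ → ℝ) (hπpos : ∀ θ ∈ Θ, 0 < π θ) (hπsum : ∑ θ ∈ Θ, π θ = 1)
    (P : ℝ → ℝ → ℝ)
    (hPnonneg : ∀ θ ∈ Θ, ∀ s ∈ S, 0 ≤ P θ s)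
    (hPsum : ∀ θ ∈ Θ, ∑ s ∈ S, P θ s = 1)
    (hMLRP : ∀ θ ∈ Θ, ∀ θ' ∈ Θ, θ < θ' → ∀ s ∈ S, ∀ s' ∈ S, s < s' →
      P θ' s' * P θ s ≥ P θ' s * P θ s')
    (Pm : ℝ → ℝ) (hPm : ∀ s, Pm s = ∑ θ ∈ Θ, π θ * P θ s)
    (θ₀ θ₁ : ℝ) (hθ₀ : θ₀ = Θ.min' hΘne) (hθ₁ : θ₁ = Θ.max' hΘne)
    (q : ℝ → ℝ)
    (hq : ∀ s, q s = if 0 < Pm s then P θ₀ s * π θ₀ / Pm s else 0) :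
    (∀ t t' : ℝ, t < t' →
      (∑ s ∈ S.filter (fun s => q s = t'), P θ₀ s) *
          (∑ s ∈ S.filter (fun s => q s = t), Pm s) ≥
        (∑ s ∈ S.filter (fun s => q s = t), P θ₀ s) *
          (∑ s ∈ S.filter (fun s => q s = t'), Pm s)) ∧
    (∀ t t' : ℝ, t < t' →
      (∑ s ∈ S.filter (fun s => q s = t'), Pm s) *
          (∑ s ∈ S.filter (fun s => q s = t), P θ₁ s) ≥
        (∑ s ∈ S.filter (fun s => q s = t), Pm s) *
          (∑ s ∈ S.filter (fun s => q s = t'), P θ₁ s)) := by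
  have h₀ : θ₀ ∈ Θ := hθ₀ ▸ Θ.min'_mem hΘne
  have h₁ : θ₁ ∈ Θ := hθ₁ ▸ Θ.max'_mem hΘne
  have hmin : ∀ θ ∈ Θ, θ₀ ≤ θ := fun θ h => hθ₀ ▸ Θ.min'_le θ h
  have hmax : ∀ θ ∈ Θ, θ ≤ θ₁ := fun θ h => hθ₁ ▸ Θ.le_max' θ h
  have hterm : ∀ s ∈ S, ∀ θ ∈ Θ, 0 ≤ π θ * P θ s := fun s hs θ hθ =>
    mul_nonneg (hπpos θ hθ).le (hPnonneg θ hθ s hs)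
  have hPm_nonneg : ∀ s ∈ S, 0 ≤ Pm s := fun s hs => by
    rw [hPm]
    exact sum_nonneg (hterm s hs)
  have hPm_zero : ∀ s ∈ S, Pm s = 0 → ∀ θ ∈ Θ, P θ s = 0 := fun s hs h θ hθ => by
    rw [hPm, sum_eq_zero_iff_of_nonneg (hterm s hs)] at h
    exact (mul_eq_zero.mp (h θ hθ)).resolve_left (hπpos θ hθ).ne'
  have hq_mul : ∀ s ∈ S, P θ₀ s * π θ₀ = q s * Pm s := fun s hs => by
    rcases (hPm_nonneg s hs).eq_or_lt with h | h
    · rw [hPm_zero s hs h.symm θ₀ h₀, ← h]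
      ring
    · rw [hq, if_pos h, div_mul_cancel₀ _ h.ne']
  have hq_nonneg : ∀ s ∈ S, 0 ≤ q s := fun s hs => by
    rw [hq]
    split_ifs with h
    · exact div_nonneg (mul_nonneg (hPnonneg θ₀ h₀ s hs) (hπpos θ₀ h₀).le) h.le
    · exact le_rfl
  constructor
  · intro t t' htt
    have hlevel : ∀ u, (∑ s ∈ S.filter (fun s => q s = u), P θ₀ s) * π θ₀ =
        u * ∑ s ∈ S.filter (fun s => q s = u), Pm s := fun u => by
      rw [sum_mul, mul_sum]
      refine sum_congr rfl fun s hs => ?_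
      rw [mem_filter] at hs
      obtain ⟨hs, rfl⟩ := hs
      exact hq_mul s hs
    have hsum_nonneg : ∀ u, 0 ≤ ∑ s ∈ S.filter (fun s => q s = u), Pm s := fun u =>
      sum_nonneg fun s hs => hPm_nonneg s (mem_filter.mp hs).1
    refine le_of_mul_le_mul_right ?_ (hπpos θ₀ h₀)
    rw [mul_right_comm, hlevel t, mul_right_comm (∑ s ∈ S.filter (fun s => q s = t'), P θ₀ s),
      hlevel t']
    nlinarith [mul_le_mul_of_nonneg_right htt.le (mul_nonneg (hsum_nonneg t) (hsum_nonneg t'))]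
  · intro t t' htt
    rw [ge_iff_le, sum_mul_sum, sum_mul_sum, sum_comm]
    refine sum_le_sum fun s' hs' => sum_le_sum fun s hs => ?_
    rw [mem_filter] at hs
    obtain ⟨hs, rfl⟩ := hs
    rw [mem_filter] at hs'
    obtain ⟨hs', rfl⟩ := hs'
    rcases (hPm_nonneg s hs).eq_or_lt with hz | hpos
    · rw [← hz, zero_mul]
      exact mul_nonneg (hPm_nonneg s' hs') (hPnonneg θ₁ h₁ s hs)
    have hpos' : 0 < Pm s' := by
      by_contra h
      have := hq_nonneg s hs
      rw [hq s', if_neg h] at htt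
      linarith
    have hlt : s' < s := by
      by_contra! hle
      have hne : s < s' := lt_of_le_of_ne hle fun h => htt.ne (by rw [h])
      have hsum : P θ₀ s' * Pm s ≤ P θ₀ s * Pm s' := by
        rw [hPm s, hPm s', mul_sum, mul_sum]
        refine sum_le_sum fun θ hθ => ?_
        rcases (hmin θ hθ).eq_or_lt with rfl | h
        · exact le_of_eq (by ring)
        · nlinarith [mul_le_mul_of_nonneg_left (hMLRP θ₀ h₀ θ hθ h s hs s' hs' hne)
            (hπpos θ hθ).le]
      have hmul := mul_le_mul_of_nonneg_right hsum (hπpos θ₀ h₀).le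
      rw [mul_right_comm, hq_mul s' hs', mul_right_comm (P θ₀ s), hq_mul s hs] at hmul
      nlinarith [mul_lt_mul_of_pos_right htt (mul_pos hpos hpos')]
    rw [hPm s, hPm s', sum_mul, sum_mul]
    refine sum_le_sum fun θ hθ => ?_
    rcases (hmax θ hθ).eq_or_lt with h | h
    · rw [h]
      exact le_of_eq (by ring)
    · nlinarith [mul_le_mul_of_nonneg_left (hMLRP θ hθ θ₁ h₁ h s' hs' s hs hlt)
        (hπpos θ hθ).le]
end

section
/- In the sequential discrete Bayesian setup, for every θ ∈ Θ, every n, and every prefix s_n ∈ X^n, the conditional law of q_{n+1}^θ given s_n under P_θ likelihood-ratio dominates its conditional law given s_n under P; that is, for all real numbers t < t', (∑_{x : q_{n+1}^θ(s_n,x)=t'} P_θ(s_n,x)) · (∑_{x : q_{n+1}^θ(s_n,x)=t} P(s_n,x)) ≥ (∑_{x : q_{n+1}^θ(s_n,x)=t} P_θ(s_n,x)) · (∑_{x : q_{n+1}^θ(s_n,x)=t'} P(s_n,x)), where all sums are over x ∈ X. -/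
open Finset
open scoped Classical

/-- Sequential discrete Bayesian setup: `Θ` and `X` finite, prior `π`
positive summing to `1`, joint pmfs `P θ` on `X^{n+1}` (written as a function of a prefix
`sn ∈ X^n` and a last observation `x ∈ X`), marginal `Pm = ∑ θ, π θ * P θ`, and posterior
at time `n+1` given by `q1 x = P θ sn x * π θ / Pm sn x` when `Pm sn x > 0` (else `0`).
Then for every `θ`, every `n`, and every prefix `sn`, the conditional law of `q_{n+1}^θ`
given `sn` under `P_θ` likelihood-ratio dominates its conditional law under `P`. -/
theorem sequential_posterior_lr_dominance
    {Θ X : Type*} [Fintype Θ] [Fintype X] {n : ℕ}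
    (π : Θ → ℝ) (hπpos : ∀ θ, 0 < π θ) (hπsum : ∑ θ, π θ = 1)
    (P : Θ → (Fin n → X) → X → ℝ)
    (hPnonneg : ∀ θ sn x, 0 ≤ P θ sn x)
    (hPsum : ∀ θ, ∑ sn : Fin n → X, ∑ x, P θ sn x = 1)
    (Pm : (Fin n → X) → X → ℝ)
    (hPm : ∀ sn x, Pm sn x = ∑ θ, π θ * P θ sn x)
    (θ : Θ) (sn : Fin n → X)
    (q1 : X → ℝ)
    (hq1 : ∀ x, q1 x = if 0 < Pm sn x then P θ sn x * π θ / Pm sn x else 0)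
    (t t' : ℝ) (htt' : t < t') :
    (∑ x ∈ univ.filter (fun x => q1 x = t'), P θ sn x) *
        (∑ x ∈ univ.filter (fun x => q1 x = t), Pm sn x) ≥
      (∑ x ∈ univ.filter (fun x => q1 x = t), P θ sn x) *
        (∑ x ∈ univ.filter (fun x => q1 x = t'), Pm sn x) := by
  have hPm_nonneg : ∀ x, 0 ≤ Pm sn x := fun x => by
    rw [hPm]
    exact sum_nonneg fun θ' _ => mul_nonneg (hπpos θ').le (hPnonneg θ' sn x)
  have bayes : ∀ x, P θ sn x * π θ = q1 x * Pm sn x := by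
    intro x
    have hle : π θ * P θ sn x ≤ Pm sn x := by
      rw [hPm]
      exact single_le_sum (f := fun θ' => π θ' * P θ' sn x)
        (fun θ' _ => mul_nonneg (hπpos θ').le (hPnonneg θ' sn x)) (mem_univ θ)
    rw [hq1]
    split_ifs with h
    · rw [div_mul_cancel₀ _ h.ne']
    · linarith [mul_nonneg (hπpos θ).le (hPnonneg θ sn x)]
  have bayes_sum : ∀ u, (∑ x ∈ univ.filter (fun x => q1 x = u), P θ sn x) * π θ =
      u * ∑ x ∈ univ.filter (fun x => q1 x = u), Pm sn x := by
    intro u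
    rw [sum_mul, mul_sum]
    refine sum_congr rfl fun x hx => ?_
    rw [bayes, (mem_filter.mp hx).2]
  have level_nonneg : ∀ u, 0 ≤ ∑ x ∈ univ.filter (fun x => q1 x = u), Pm sn x :=
    fun u => sum_nonneg fun x _ => hPm_nonneg x
  refine le_of_mul_le_mul_right ?_ (hπpos θ)
  set M := fun u => ∑ x ∈ univ.filter (fun x => q1 x = u), Pm sn x
  linear_combination M t' * bayes_sum t - M t * bayes_sum t' +
    mul_le_mul_of_nonneg_right htt'.le (mul_nonneg (level_nonneg t) (level_nonneg t'))
end

section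
/- In the sequential discrete Bayesian setup, the posterior process is a submartingale under the true parameter: for every θ ∈ Θ, every n, and every prefix s_n ∈ X^n with P(s_n) > 0, one has ∑_{x∈X} P_θ(s_n, x) · q_{n+1}^θ(s_n, x) ≥ P_θ(s_n) · q_n^θ(s_n); equivalently, E_θ[q_{n+1}^θ | s_n] ≥ q_n^θ(s_n) whenever P_θ(s_n) > 0. -/
open Finset

/-- In the sequential discrete Bayesian setup, the posterior process is a
submartingale under the true parameter: for every `θ`, every `n`, and every prefix `sn` with
positive marginal probability, `∑ x, P θ sn x * q_{n+1}^θ(sn, x) ≥ P_θ(sn) * q_n^θ(sn)`. -/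
theorem posterior_submartingale
    {Θ X : Type*} [Fintype Θ] [Fintype X] {n : ℕ}
    (π : Θ → ℝ) (hπpos : ∀ θ, 0 < π θ) (hπsum : ∑ θ, π θ = 1)
    (P : Θ → (Fin n → X) → X → ℝ)
    (hPnonneg : ∀ θ sn x, 0 ≤ P θ sn x)
    (hPsum : ∀ θ, ∑ sn : Fin n → X, ∑ x, P θ sn x = 1)
    (Ppre : Θ → (Fin n → X) → ℝ)
    (hPpre : ∀ θ sn, Ppre θ sn = ∑ x, P θ sn x)
    (Pm : (Fin n → X) → X → ℝ)
    (hPm : ∀ sn x, Pm sn x = ∑ θ, π θ * P θ sn x)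
    (Pmpre : (Fin n → X) → ℝ)
    (hPmpre : ∀ sn, Pmpre sn = ∑ x, Pm sn x)
    (θ : Θ)
    (qn : (Fin n → X) → ℝ)
    (hqn : ∀ sn, qn sn = if 0 < Pmpre sn then Ppre θ sn * π θ / Pmpre sn else 0)
    (q1 : (Fin n → X) → X → ℝ)
    (hq1 : ∀ sn x, q1 sn x = if 0 < Pm sn x then P θ sn x * π θ / Pm sn x else 0)
    (sn : Fin n → X) (hpos : 0 < Pmpre sn) :
    ∑ x, P θ sn x * q1 sn x ≥ Ppre θ sn * qn sn := by
  have hPm_nonneg : ∀ x, 0 ≤ Pm sn x := fun x ↦ by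
    rw [hPm]
    exact Finset.sum_nonneg fun t _ ↦ mul_nonneg (hπpos t).le (hPnonneg t sn x)
  have hP_zero : ∀ x, Pm sn x = 0 → P θ sn x = 0 := fun x hx ↦ by
    rw [hPm, Finset.sum_eq_zero_iff_of_nonneg
      fun t _ ↦ mul_nonneg (hπpos t).le (hPnonneg t sn x)] at hx
    exact (mul_eq_zero.mp (hx θ (Finset.mem_univ θ))).resolve_left (hπpos θ).ne'
  have hq1_nonneg : ∀ x, 0 ≤ q1 sn x := fun x ↦ by
    rw [hq1]
    split_ifs with h
    · exact div_nonneg (mul_nonneg (hPnonneg θ sn x) (hπpos θ).le) h.le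
    · exact le_rfl
  have hbayes : ∀ x, q1 sn x * Pm sn x = P θ sn x * π θ := fun x ↦ by
    rw [hq1]
    split_ifs with h
    · exact div_mul_cancel₀ _ h.ne'
    · rw [hP_zero x (le_antisymm (not_lt.mp h) (hPm_nonneg x)), zero_mul, zero_mul]
  have hcs : (∑ x, P θ sn x) ^ 2 ≤ (∑ x, P θ sn x * q1 sn x / π θ) * ∑ x, Pm sn x :=
    Finset.sum_sq_le_sum_mul_sum_of_sq_le_mul _
      (fun x _ ↦ div_nonneg (mul_nonneg (hPnonneg θ sn x) (hq1_nonneg x)) (hπpos θ).le)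
      (fun x _ ↦ hPm_nonneg x)
      (fun x _ ↦ le_of_eq <| by
        rw [div_mul_eq_mul_div, mul_assoc, hbayes, eq_div_iff (hπpos θ).ne']
        ring)
  rw [← Finset.sum_div, div_mul_eq_mul_div, le_div_iff₀ (hπpos θ), ← hPmpre, ← hPpre] at hcs
  rw [ge_iff_le, hqn, if_pos hpos, ← mul_div_assoc, div_le_iff₀ hpos]
  linarith
end

section
/- In the sequential discrete Bayesian setup, for every θ ∈ Θ, every n, and every function f : ℝ → ℝ that is monotone increasing and convex on [0,1], the expectation of f of the θ-posterior under P_θ increases with an additional observation: ∑_{s_{n+1} ∈ X^{n+1}} P_θ(s_{n+1}) · f(q_{n+1}^θ(s_{n+1})) ≥ ∑_{s_n ∈ X^n} P_θ(s_n) · f(q_n^θ(s_n)). In particular (taking f the identity), E_θ[q_{n+1}^θ] ≥ E_θ[q_n^θ], so the expected posterior probability of θ under P_θ is increasing in the number of observations. -/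
open Finset

/-- Sedrakyan's inequality, allowing vanishing denominators where the numerator vanishes too. -/
theorem sq_sum_div_le_sum_sq_div_of_le {X : Type*} [Fintype X] {p m : X → ℝ} {c : ℝ} (hc : 0 < c)
    (hp : ∀ x, 0 ≤ p x) (hpm : ∀ x, c * p x ≤ m x) (hm : 0 < ∑ x, m x) :
    (∑ x, p x) ^ 2 / ∑ x, m x ≤ ∑ x, p x ^ 2 / m x := by
  set t := (∑ x, p x) / ∑ x, m x with ht
  have tangent : ∀ x, 2 * t * p x - t ^ 2 * m x ≤ p x ^ 2 / m x := by
    intro x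
    rcases ((mul_nonneg hc.le (hp x)).trans (hpm x)).eq_or_lt with h | h
    · have hx : p x = 0 := by
        have := hpm x
        have := hp x
        nlinarith
      simp [hx, ← h]
    · rw [le_div_iff₀ h]
      nlinarith [sq_nonneg (p x - t * m x)]
  calc (∑ x, p x) ^ 2 / ∑ x, m x = ∑ x, (2 * t * p x - t ^ 2 * m x) := by
        rw [sum_sub_distrib, ← mul_sum, ← mul_sum, ht]
        field_simp
        ring
    _ ≤ _ := sum_le_sum fun x _ => tangent x

/-- Jensen's inequality for the posterior `p x * c / m x` under the weights `p x`. -/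
theorem sum_mul_apply_posterior_le {X : Type*} [Fintype X] {p m : X → ℝ} {c : ℝ} (hc : 0 < c)
    (hp : ∀ x, 0 ≤ p x) (hpm : ∀ x, c * p x ≤ m x) {f : ℝ → ℝ}
    (hf_mono : MonotoneOn f (Set.Icc (0 : ℝ) 1)) (hf_conv : ConvexOn ℝ (Set.Icc (0 : ℝ) 1) f) :
    (∑ x, p x) * f ((∑ x, p x) * c / ∑ x, m x) ≤ ∑ x, p x * f (p x * c / m x) := by
  have posterior_mem : ∀ {a b : ℝ}, 0 ≤ a → c * a ≤ b → a * c / b ∈ Set.Icc (0 : ℝ) 1 := by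
    intro a b ha hab
    have hca : 0 ≤ c * a := by positivity
    exact ⟨div_nonneg (by linarith) (by linarith), div_le_one_of_le₀ (by linarith) (by linarith)⟩
  rcases (sum_nonneg fun x (_ : x ∈ univ) => hp x).eq_or_lt with h | h
  · have hx : ∀ x, p x = 0 := fun x =>
      (sum_eq_zero_iff_of_nonneg fun x _ => hp x).1 h.symm x (mem_univ x)
    simp [hx]
  · have hsum : c * ∑ x, p x ≤ ∑ x, m x := by
      rw [mul_sum]
      exact sum_le_sum fun x _ => hpm x
    have hm : 0 < ∑ x, m x := (mul_pos hc h).trans_le hsum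
    have hw : ∀ x ∈ univ, 0 ≤ p x / ∑ y, p y := fun x _ => div_nonneg (hp x) h.le
    have hw1 : ∑ x, p x / ∑ y, p y = 1 := by rw [← sum_div, div_self h.ne']
    have hmem : ∀ x ∈ univ, p x * c / m x ∈ Set.Icc (0 : ℝ) 1 :=
      fun x _ => posterior_mem (hp x) (hpm x)
    have jensen := hf_conv.map_sum_le hw hw1 hmem
    have hmean : ∑ x, (p x / ∑ y, p y) • (p x * c / m x) ∈ Set.Icc (0 : ℝ) 1 :=
      hf_conv.1.sum_mem hw hw1 hmem
    have hle : (∑ x, p x) * c / ∑ x, m x ≤ ∑ x, (p x / ∑ y, p y) • (p x * c / m x) := by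
      have heq : ∑ x, (p x / ∑ y, p y) • (p x * c / m x)
          = c / (∑ y, p y) * ∑ x, p x ^ 2 / m x := by
        rw [mul_sum]
        refine sum_congr rfl fun x _ => ?_
        rw [smul_eq_mul]
        ring
      have heq' : (∑ x, p x) * c / ∑ x, m x
          = c / (∑ y, p y) * ((∑ x, p x) ^ 2 / ∑ x, m x) := by
        field_simp
      rw [heq, heq']
      exact mul_le_mul_of_nonneg_left (sq_sum_div_le_sum_sq_div_of_le hc hp hpm hm) (by positivity)
    have key := (hf_mono (posterior_mem h.le hsum) hmean hle).trans jensen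
    calc _ ≤ (∑ x, p x) * ∑ x, (p x / ∑ y, p y) • f (p x * c / m x) :=
          mul_le_mul_of_nonneg_left key h.le
      _ = _ := by
          rw [mul_sum]
          refine sum_congr rfl fun x _ => ?_
          rw [smul_eq_mul]
          field_simp

/-- In the sequential discrete Bayesian setup, for every `θ ∈ Θ`, every `n`,
and every function `f : ℝ → ℝ` that is increasing and convex on `[0,1]`, the expectation of
`f` of the `θ`-posterior under `P_θ` increases with an additional observation; in particular
(taking `f` the identity) the expected posterior probability of `θ` under `P_θ` is increasing
in the number of observations. -/
theorem expected_posterior_increasing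
    {Θ X : Type*} [Fintype Θ] [Fintype X] {n : ℕ}
    (π : Θ → ℝ) (hπpos : ∀ θ, 0 < π θ) (hπsum : ∑ θ, π θ = 1)
    (P : Θ → (Fin n → X) → X → ℝ)
    (hPnonneg : ∀ θ sn x, 0 ≤ P θ sn x)
    (hPsum : ∀ θ, ∑ sn : Fin n → X, ∑ x, P θ sn x = 1)
    (Ppre : Θ → (Fin n → X) → ℝ)
    (hPpre : ∀ θ sn, Ppre θ sn = ∑ x, P θ sn x)
    (Pm : (Fin n → X) → X → ℝ)
    (hPm : ∀ sn x, Pm sn x = ∑ θ, π θ * P θ sn x)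
    (Pmpre : (Fin n → X) → ℝ)
    (hPmpre : ∀ sn, Pmpre sn = ∑ x, Pm sn x)
    (θ : Θ)
    (qn : (Fin n → X) → ℝ)
    (hqn : ∀ sn, qn sn = if 0 < Pmpre sn then Ppre θ sn * π θ / Pmpre sn else 0)
    (q1 : (Fin n → X) → X → ℝ)
    (hq1 : ∀ sn x, q1 sn x = if 0 < Pm sn x then P θ sn x * π θ / Pm sn x else 0)
    (f : ℝ → ℝ)
    (hf_mono : MonotoneOn f (Set.Icc (0:ℝ) 1))
    (hf_conv : ConvexOn ℝ (Set.Icc (0:ℝ) 1) f) :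
    (∑ sn : Fin n → X, ∑ x, P θ sn x * f (q1 sn x)) ≥
      (∑ sn : Fin n → X, Ppre θ sn * f (qn sn)) ∧
    (∑ sn : Fin n → X, ∑ x, P θ sn x * q1 sn x) ≥
      (∑ sn : Fin n → X, Ppre θ sn * qn sn) := by
  have hdom : ∀ sn x, π θ * P θ sn x ≤ Pm sn x := by
    intro sn x
    rw [hPm]
    exact single_le_sum (f := fun θ => π θ * P θ sn x)
      (fun θ _ => mul_nonneg (hπpos θ).le (hPnonneg θ sn x)) (mem_univ θ)
  have hPm0 : ∀ sn x, 0 ≤ Pm sn x := fun sn x =>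
    (mul_nonneg (hπpos θ).le (hPnonneg θ sn x)).trans (hdom sn x)
  have ite_eq_div : ∀ a b : ℝ, 0 ≤ b → (if 0 < b then a / b else 0) = a / b := by
    intro a b hb
    rcases hb.eq_or_lt with rfl | hb
    · simp
    · simp [hb]
  have main : ∀ g : ℝ → ℝ, MonotoneOn g (Set.Icc (0 : ℝ) 1) → ConvexOn ℝ (Set.Icc (0 : ℝ) 1) g →
      ∑ sn : Fin n → X, Ppre θ sn * g (qn sn) ≤
        ∑ sn : Fin n → X, ∑ x, P θ sn x * g (q1 sn x) := by
    intro g hg_mono hg_conv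
    refine sum_le_sum fun sn _ => ?_
    simp only [hqn, hq1, hPmpre, hPpre]
    rw [ite_eq_div _ _ (sum_nonneg fun x _ => hPm0 sn x)]
    simp only [ite_eq_div _ _ (hPm0 sn _)]
    exact sum_mul_apply_posterior_le (hπpos θ) (hPnonneg θ sn) (hdom sn) hg_mono hg_conv
  exact ⟨main f hf_mono hf_conv,
    main (fun y => y) (fun _ _ _ _ h => h) (convexOn_id (convex_Icc 0 1))⟩
end

section
/- In the single Bernoulli observation setup, for any θ₀, θ₁ ∈ Θ, the inequality E_{θ₁}[q^{θ₀}] ≤ π(θ₀) holds if and only if θ̄ lies between θ₀ and θ₁ (i.e., min(θ₀,θ₁) ≤ θ̄ ≤ max(θ₀,θ₁)), with equality E_{θ₁}[q^{θ₀}] = π(θ₀) if and only if θ̄ = θ₀ or θ̄ = θ₁. -/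
open Finset

/-- A point lies between two others iff the product of the signed distances is nonpositive. -/
theorem sub_mul_sub_nonpos_iff_between (a b m : ℝ) :
    (a - m) * (b - m) ≤ 0 ↔ min a b ≤ m ∧ m ≤ max a b := by
  rw [mul_nonpos_iff, min_le_iff, le_max_iff]
  grind

/-- The excess of the expected posterior over the prior weight `p`, in factored form. -/
theorem expected_posterior_sub_prior (a b m p : ℝ) (hm0 : 0 < m) (hm1 : m < 1) :
    b * (a * p / m) + (1 - b) * ((1 - a) * p / (1 - m)) - p =
      p / (m * (1 - m)) * ((a - m) * (b - m)) := by
  have h0 : m ≠ 0 := hm0.ne'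
  have h1 : 1 - m ≠ 0 := (sub_pos.2 hm1).ne'
  field_simp
  ring

/-- Single Bernoulli observation: `Θ ⊆ [0,1]` finite, prior `π` positive
summing to `1`, prior mean `θb = ∑ θ, θ π θ` with `0 < θb < 1`, and expected posterior
`E = θ₁ q^{θ₀}(1) + (1−θ₁) q^{θ₀}(0)` where `q^{θ₀}(1) = θ₀ π θ₀ / θb` and
`q^{θ₀}(0) = (1−θ₀) π θ₀ / (1−θb)`.  Then `E ≤ π θ₀` iff `θb` lies between `θ₀` and `θ₁`,
with equality iff `θb = θ₀` or `θb = θ₁`. -/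
theorem bernoulli_expected_posterior_vs_prior
    (Θ : Finset ℝ) (hΘ : ∀ θ ∈ Θ, θ ∈ Set.Icc (0:ℝ) 1)
    (π : ℝ → ℝ) (hπpos : ∀ θ ∈ Θ, 0 < π θ) (hπsum : ∑ θ ∈ Θ, π θ = 1)
    (θb : ℝ) (hθb : θb = ∑ θ ∈ Θ, θ * π θ) (hθb0 : 0 < θb) (hθb1 : θb < 1)
    (θ₀ θ₁ : ℝ) (hθ₀ : θ₀ ∈ Θ) (hθ₁ : θ₁ ∈ Θ)
    (E : ℝ)
    (hE : E = θ₁ * (θ₀ * π θ₀ / θb) + (1 - θ₁) * ((1 - θ₀) * π θ₀ / (1 - θb))) :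
    (E ≤ π θ₀ ↔ min θ₀ θ₁ ≤ θb ∧ θb ≤ max θ₀ θ₁) ∧
    (E = π θ₀ ↔ θb = θ₀ ∨ θb = θ₁) := by
  have hsub := expected_posterior_sub_prior θ₀ θ₁ θb (π θ₀) hθb0 hθb1
  rw [← hE] at hsub
  have hc : 0 < π θ₀ / (θb * (1 - θb)) :=
    div_pos (hπpos θ₀ hθ₀) (mul_pos hθb0 (sub_pos.2 hθb1))
  constructor
  · rw [← sub_nonpos, hsub, ← mul_zero (π θ₀ / (θb * (1 - θb))), mul_le_mul_iff_right₀ hc,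
      sub_mul_sub_nonpos_iff_between]
  · rw [← sub_eq_zero, hsub, mul_eq_zero, or_iff_right hc.ne', mul_eq_zero, sub_eq_zero,
      sub_eq_zero, eq_comm, eq_comm (a := θ₁)]
end

section
/- In the one-dimensional exponential family setup, let θ₀, θ₁ ∈ Θ. Then there is a unique θ₂ ∈ Θ with η(θ₂) = (η(θ₀)+η(θ₁))/2 (it lies between θ₀ and θ₁), and with w := (∫_X √(p_{θ₀}(x) p_{θ₁}(x)) dν(x))², the identity ψ_{θ₀,θ₁}(n) = (π(θ₀)/π(θ₂)) · ψ_{θ₂,θ₂}(n) · w^n holds for every n ≥ 1. Moreover w ≤ 1, with equality w = 1 if and only if θ₀ = θ₁. -/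
open MeasureTheory

/-- The expected `θ₀`-posterior after `n` iid observations generated under `θ₁`:
`ψ_{θ₀,θ₁}(n) = ∫_{X^n} (p_{θ₀}(s_n) π(θ₀) / p(s_n)) p_{θ₁}(s_n) dν^n(s_n)`, where
`p_θ(s_n) = ∏ i, p_θ(x_i)` and `p(s_n) = ∫_Θ p_θ(s_n) π(θ) dθ`. -/
noncomputable def expectedPosterior {X : Type*} [MeasurableSpace X]
    (ν : Measure X) [SigmaFinite ν]
    (Θ : Set ℝ) (π : ℝ → ℝ) (p : ℝ → X → ℝ) (θ₀ θ₁ : ℝ) (n : ℕ) : ℝ :=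
  ∫ s : Fin n → X,
    ((∏ i, p θ₀ (s i)) * π θ₀ / ∫ θ in Θ, (∏ i, p θ (s i)) * π θ) *
      (∏ i, p θ₁ (s i)) ∂(Measure.pi fun _ => ν)

/-- In an exponential family, `p a * p b` is a constant multiple of the square of the member whose
natural parameter is the midpoint of the natural parameters of `a` and `b`. -/
lemma exponential_family_mul_eq_sq {X : Type*} {η : ℝ → ℝ} {T B : X → ℝ} {A : ℝ → ℝ}
    {p : ℝ → X → ℝ} (hp : ∀ θ x, p θ x = Real.exp (η θ * T x - A (η θ) - B x))
    {a b m : ℝ} (hm : η m = (η a + η b) / 2) (x : X) :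
    p a x * p b x = Real.exp (2 * A (η m) - A (η a) - A (η b)) * p m x ^ 2 := by
  rw [hp, hp, hp, ← Real.exp_add, ← Real.exp_nat_mul, ← Real.exp_add, hm]
  congr 1
  push_cast
  ring

/-- If `p a * p b = c * p m ^ 2` pointwise, the expected posterior at `a` under `b` is a constant
multiple of the expected posterior at `m` under `m`. -/
lemma expectedPosterior_eq_of_mul_eq_sq {X : Type*} [MeasurableSpace X]
    (ν : Measure X) [SigmaFinite ν] (Θ : Set ℝ) (π : ℝ → ℝ) (p : ℝ → X → ℝ) {a b m c : ℝ}
    (hm : π m ≠ 0) (h : ∀ x, p a x * p b x = c * p m x ^ 2) (n : ℕ) :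
    expectedPosterior ν Θ π p a b n = π a / π m * expectedPosterior ν Θ π p m m n * c ^ n := by
  have hprod (s : Fin n → X) :
      (∏ i, p a (s i)) * ∏ i, p b (s i) = c ^ n * (∏ i, p m (s i)) ^ 2 := by
    rw [← Finset.prod_mul_distrib, Finset.prod_congr rfl fun i _ => h (s i),
      Finset.prod_mul_distrib, Finset.prod_pow]
    simp
  unfold expectedPosterior
  rw [mul_right_comm, ← integral_const_mul]
  congr 1 with s
  rw [div_mul_eq_mul_div, mul_right_comm, hprod]
  field_simp

/-- A function with positive second derivative on a convex set lies strictly below its chords at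
midpoints. -/
lemma two_mul_map_midpoint_lt {A : ℝ → ℝ} (hA : Continuous A) {s : Set ℝ} (hs : Convex ℝ s)
    (hA'' : ∀ y ∈ s, 0 < iteratedDeriv 2 A y) {u v : ℝ} (hu : u ∈ s) (hv : v ∈ s) (huv : u ≠ v) :
    2 * A ((u + v) / 2) < A u + A v := by
  have hconv : StrictConvexOn ℝ s A := strictConvexOn_of_deriv2_pos' hs hA.continuousOn
    fun y hy => by simpa only [iteratedDeriv_eq_iterate] using hA'' y hy
  have h := hconv.2 hu hv huv (half_pos one_pos) (half_pos one_pos) (add_halves 1)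
  simp only [smul_eq_mul] at h
  rw [show (u + v) / 2 = 1 / 2 * u + 1 / 2 * v by ring]
  linarith

/-- One-dimensional exponential family setup.  For `θ₀, θ₁ ∈ Θ` there is a
unique `θ₂ ∈ Θ` with `η θ₂ = (η θ₀ + η θ₁)/2` (it lies between `θ₀` and `θ₁`), and with
`w = (∫ √(p_{θ₀} p_{θ₁}) dν)²` one has `ψ_{θ₀,θ₁}(n) = (π θ₀ / π θ₂) ψ_{θ₂,θ₂}(n) wⁿ` for all
`n ≥ 1`; moreover `w ≤ 1`, with `w = 1` iff `θ₀ = θ₁`. -/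
theorem exponential_family_reduction
    {X : Type*} [MeasurableSpace X] (ν : Measure X) [SigmaFinite ν]
    (Θ : Set ℝ) (hΘconv : Convex ℝ Θ) (hΘnontriv : ∃ a ∈ Θ, ∃ b ∈ Θ, a ≠ b)
    (η ηd : ℝ → ℝ)
    (hη : ∀ θ ∈ Θ, HasDerivWithinAt η (ηd θ) Θ θ)
    (hηd : ∀ θ ∈ Θ, 0 < ηd θ)
    (T B : X → ℝ) (hT : Measurable T) (hB : Measurable B)
    (A : ℝ → ℝ) (hA : ContDiff ℝ 2 A)
    (hA'' : ∀ θ ∈ Θ, 0 < iteratedDeriv 2 A (η θ))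
    (p : ℝ → X → ℝ)
    (hp : ∀ θ x, p θ x = Real.exp (η θ * T x - A (η θ) - B x))
    (hpint : ∀ θ ∈ Θ, ∫ x, p θ x ∂ν = 1)
    (π : ℝ → ℝ) (hπc : ContinuousOn π Θ) (hπpos : ∀ θ ∈ Θ, 0 < π θ)
    (hπint : ∫ θ in Θ, π θ = 1)
    (θ₀ θ₁ : ℝ) (hθ₀ : θ₀ ∈ Θ) (hθ₁ : θ₁ ∈ Θ)
    (w : ℝ) (hw : w = (∫ x, Real.sqrt (p θ₀ x * p θ₁ x) ∂ν) ^ 2) :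
    ∃ θ₂ ∈ Θ, η θ₂ = (η θ₀ + η θ₁) / 2 ∧
      (∀ θ₂' ∈ Θ, η θ₂' = (η θ₀ + η θ₁) / 2 → θ₂' = θ₂) ∧
      θ₂ ∈ Set.Icc (min θ₀ θ₁) (max θ₀ θ₁) ∧
      (∀ n : ℕ, 1 ≤ n →
        expectedPosterior ν Θ π p θ₀ θ₁ n =
          (π θ₀ / π θ₂) * expectedPosterior ν Θ π p θ₂ θ₂ n * w ^ n) ∧
      w ≤ 1 ∧ (w = 1 ↔ θ₀ = θ₁) := by
  have hcont : ContinuousOn η Θ := fun θ hθ => (hη θ hθ).continuousWithinAt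
  have hmono : StrictMonoOn η Θ := strictMonoOn_of_hasDerivWithinAt_pos hΘconv hcont
    (fun θ hθ => (hη θ (interior_subset hθ)).mono interior_subset)
    fun θ hθ => hηd θ (interior_subset hθ)
  have hsub : Set.uIcc θ₀ θ₁ ⊆ Θ := hΘconv.ordConnected.uIcc_subset hθ₀ hθ₁
  have hmid : (η θ₀ + η θ₁) / 2 ∈ Set.uIcc (η θ₀) (η θ₁) := by
    rw [Set.mem_uIcc]
    rcases le_total (η θ₀) (η θ₁) with h | h
    · left; constructor <;> linarith
    · right; constructor <;> linarith
  obtain ⟨θ₂, hθ₂I, hθ₂η⟩ := intermediate_value_uIcc (hcont.mono hsub) hmid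
  have hθ₂ : θ₂ ∈ Θ := hsub hθ₂I
  have hmul := exponential_family_mul_eq_sq hp hθ₂η
  have hwc : w = Real.exp (2 * A (η θ₂) - A (η θ₀) - A (η θ₁)) := by
    have hsqrt (x : X) : √(p θ₀ x * p θ₁ x) =
        √(Real.exp (2 * A (η θ₂) - A (η θ₀) - A (η θ₁))) * p θ₂ x := by
      rw [hmul, Real.sqrt_mul (Real.exp_pos _).le, Real.sqrt_sq]
      rw [hp]
      exact (Real.exp_pos _).le
    simp_rw [hw, hsqrt]
    rw [integral_const_mul, hpint θ₂ hθ₂, mul_one, Real.sq_sqrt (Real.exp_pos _).le]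
  have himage : Convex ℝ (η '' Θ) :=
    (hΘconv.isPreconnected.image η hcont).ordConnected.convex
  have hlt (hne : θ₀ ≠ θ₁) : w < 1 := by
    have := two_mul_map_midpoint_lt hA.continuous himage (Set.forall_mem_image.2 hA'')
      (Set.mem_image_of_mem η hθ₀) (Set.mem_image_of_mem η hθ₁) (hmono.injOn.ne hθ₀ hθ₁ hne)
    rw [hwc, Real.exp_lt_one_iff, hθ₂η]
    linarith
  have heq (h : θ₀ = θ₁) : w = 1 := by
    subst h
    rw [hwc, Real.exp_eq_one_iff, hθ₂η, add_self_div_two]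
    ring
  refine ⟨θ₂, hθ₂, hθ₂η, fun θ hθ h => hmono.injOn hθ hθ₂ (h.trans hθ₂η.symm), hθ₂I,
    fun n _ => ?_, ?_, fun h => ?_, heq⟩
  · rw [hwc]
    exact expectedPosterior_eq_of_mul_eq_sq ν Θ π p (hπpos θ₂ hθ₂).ne' hmul n
  · by_cases h : θ₀ = θ₁
    · exact (heq h).le
    · exact (hlt h).le
  · by_contra hne
    exact (hlt hne).ne h
end

section
/- In the one-dimensional exponential family setup, let θ₀ be an interior point of Θ and let I(θ₀) := A''(η(θ₀))·(η'(θ₀))² be the Fisher information at θ₀. Then E_{θ₀}[q_n^{θ₀}] = ψ_{θ₀,θ₀}(n) is asymptotically equivalent to (√(I(θ₀))/(2√π)) · √n as n → ∞; that is, lim_{n→∞} ψ_{θ₀,θ₀}(n) · 2√π / (√(I(θ₀)) · √n) = 1. -/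
open MeasureTheory

section

open Filter Topology ProbabilityTheory Set

theorem tendsto_integral_of_tendsto_of_continuous_convergence
    {μ : ℕ → ProbabilityMeasure ℝ} {μ₀ : ProbabilityMeasure ℝ} (hμ : Tendsto μ atTop (𝓝 μ₀))
    {F : ℕ → ℝ → ℝ} {F₀ : ℝ → ℝ} (hF : ∀ n, Measurable (F n)) (hF₀ : Continuous F₀) {C : ℝ}
    (hC : ∀ᶠ n in atTop, ∀ x, |F n x| ≤ C) (hC₀ : ∀ x, |F₀ x| ≤ C)
    (hlim : ∀ x, Tendsto (fun q : ℕ × ℝ => F q.1 q.2) (atTop ×ˢ 𝓝 x) (𝓝 (F₀ x))) :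
    Tendsto (fun n => ∫ x, F n x ∂(μ n : Measure ℝ)) atTop
      (𝓝 (∫ x, F₀ x ∂(μ₀ : Measure ℝ))) := by
  have hC0 : 0 ≤ C := (abs_nonneg _).trans (hC₀ 0)
  have hweak : Tendsto (fun n => ∫ x, F₀ x ∂(μ n : Measure ℝ)) atTop
      (𝓝 (∫ x, F₀ x ∂(μ₀ : Measure ℝ))) :=
    ProbabilityMeasure.tendsto_iff_forall_integral_tendsto.1 hμ
      (BoundedContinuousFunction.ofNormedAddCommGroup F₀ hF₀ C hC₀)
  have htight : IsTightMeasureSet {((ρ : ProbabilityMeasure ℝ) : Measure ℝ) | ρ ∈ range μ} := by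
    apply isTightMeasureSet_of_isCompact_closure
    exact hμ.isCompact_insert_range.closure_of_subset (subset_insert _ _)
  suffices h : Tendsto (fun n => ∫ x, F n x ∂(μ n : Measure ℝ) - ∫ x, F₀ x ∂(μ n : Measure ℝ))
      atTop (𝓝 0) by
    simpa using h.add hweak
  rw [Metric.tendsto_nhds]
  intro ε hε
  obtain ⟨K, hK, hKμ⟩ := isTightMeasureSet_iff_exists_isCompact_measure_compl_le.1 htight
    (ENNReal.ofReal (ε / (2 * (2 * C + 1)))) (by positivity)
  have hunif : TendstoUniformlyOn F F₀ atTop K := by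
    rw [← tendstoLocallyUniformlyOn_iff_tendstoUniformlyOn_of_compact hK]
    apply TendstoLocallyUniformly.tendstoLocallyUniformlyOn
    rw [tendstoLocallyUniformly_iff_forall_tendsto]
    intro x
    rw [Metric.uniformity_eq_comap_nhds_zero, tendsto_comap_iff]
    have h1 : Tendsto (fun q : ℕ × ℝ => F₀ q.2) (atTop ×ˢ 𝓝 x) (𝓝 (F₀ x)) :=
      (hF₀.tendsto x).comp tendsto_snd
    have h2 := h1.dist (hlim x)
    rwa [dist_self] at h2
  filter_upwards [hC, Metric.tendstoUniformlyOn_iff.1 hunif (ε / 4) (by positivity)]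
    with n hn hnK
  have hi1 : Integrable (F n) (μ n : Measure ℝ) :=
    Integrable.of_bound (hF n).aestronglyMeasurable C (ae_of_all _ hn)
  have hi2 : Integrable F₀ (μ n : Measure ℝ) :=
    Integrable.of_bound hF₀.aestronglyMeasurable C (ae_of_all _ hC₀)
  have hmK : MeasurableSet Kᶜ := hK.measurableSet.compl
  have hKn : (μ n : Measure ℝ).real Kᶜ ≤ ε / (2 * (2 * C + 1)) := by
    have := hKμ (μ n) ⟨μ n, mem_range_self n, rfl⟩
    exact ENNReal.toReal_le_of_le_ofReal (by positivity) this
  rw [dist_zero_right, ← integral_sub hi1 hi2]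
  calc ‖∫ x, (F n x - F₀ x) ∂(μ n : Measure ℝ)‖
      ≤ ∫ x, (ε / 4 + Kᶜ.indicator (fun _ => 2 * C) x) ∂(μ n : Measure ℝ) := by
        apply norm_integral_le_of_norm_le
        · exact (integrable_const _).add ((integrable_const _).indicator hmK)
        · refine ae_of_all _ fun x => ?_
          by_cases hx : x ∈ K
          · have := hnK x hx
            rw [dist_comm, dist_eq_norm] at this
            simpa [hx] using this.le
          · have h1 := hn x
            have h2 := hC₀ x
            have h3 := norm_sub_le (F n x) (F₀ x)
            simp only [Real.norm_eq_abs] at *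
            simp only [mem_compl_iff, hx, not_false_eq_true, indicator_of_mem]
            linarith
    _ = ε / 4 + (μ n : Measure ℝ).real Kᶜ * (2 * C) := by
        rw [integral_add (integrable_const _) ((integrable_const _).indicator hmK),
          integral_indicator hmK]
        simp
    _ ≤ ε / 4 + ε / (2 * (2 * C + 1)) * (2 * C + 1) := by gcongr; linarith
    _ = ε / 4 + ε / 2 := by field_simp
    _ < ε := by linarith

theorem integral_gaussianReal_exp_neg_sq_div {v : ℝ} (hv : 0 < v) :
    ∫ z, Real.exp (-(z ^ 2 / (2 * v))) ∂(gaussianReal 0 v.toNNReal) = (√2)⁻¹ := by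
  rw [integral_gaussianReal_eq_integral_smul (by simpa using hv)]
  have h (z : ℝ) : gaussianPDFReal 0 v.toNNReal z • Real.exp (-(z ^ 2 / (2 * v))) =
      (√(2 * Real.pi * v))⁻¹ * Real.exp (-(1 / v) * z ^ 2) := by
    rw [gaussianPDFReal, Real.coe_toNNReal _ hv.le, smul_eq_mul, mul_assoc, ← Real.exp_add]
    congr 2
    field_simp
    ring
  simp_rw [h]
  rw [integral_const_mul, integral_gaussian, show 2 * Real.pi * v = 2 * (Real.pi / (1 / v)) by
    field_simp, Real.sqrt_mul (by norm_num), mul_inv, mul_assoc, inv_mul_cancel₀ (by positivity),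
    mul_one]

theorem pi_withDensity_ofReal {X ι : Type*} [MeasurableSpace X] [Fintype ι] {ν : Measure X}
    [SigmaFinite ν] {f : X → ℝ} (hf0 : ∀ x, 0 ≤ f x) (hfi : Integrable f ν) :
    Measure.pi (fun _ : ι => ν.withDensity fun x => ENNReal.ofReal (f x)) =
      (Measure.pi fun _ : ι => ν).withDensity fun s => ENNReal.ofReal (∏ i, f (s i)) := by
  have : IsFiniteMeasure (ν.withDensity fun x => ENNReal.ofReal (f x)) :=
    isFiniteMeasure_withDensity_ofReal hfi.2
  refine Measure.pi_eq fun t ht => ?_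
  rw [withDensity_apply _ (MeasurableSet.univ_pi ht), Measure.restrict_pi_pi,
    ← ofReal_integral_eq_lintegral_ofReal
      (Integrable.fintype_prod (f := fun _ => f) fun i => hfi.restrict)
      (ae_of_all _ fun s => Finset.prod_nonneg fun i _ => hf0 _),
    integral_fintype_prod_eq_prod (fun _ => f),
    ENNReal.ofReal_prod_of_nonneg fun i _ => integral_nonneg hf0]
  refine Finset.prod_congr rfl fun i _ => ?_
  rw [withDensity_apply _ (ht i),
    ofReal_integral_eq_lintegral_ofReal hfi.restrict (ae_of_all _ hf0)]

theorem tendsto_integral_pi_of_continuous_convergence {X : Type*} [MeasurableSpace X]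
    (P : Measure X) [IsProbabilityMeasure P] {T : X → ℝ} (hT : Measurable T)
    (hT2 : MemLp T 2 P) {F : ℕ → ℝ → ℝ} {F₀ : ℝ → ℝ} (hF : ∀ n, Measurable (F n))
    (hF₀ : Continuous F₀) {C : ℝ}
    (hC : ∀ᶠ n in atTop, ∀ x, |F n x| ≤ C) (hC₀ : ∀ x, |F₀ x| ≤ C)
    (hlim : ∀ x, Tendsto (fun q : ℕ × ℝ => F q.1 q.2) (atTop ×ˢ 𝓝 x) (𝓝 (F₀ x))) :
    Tendsto (fun n : ℕ => ∫ s : Fin n → X, F n ((√n)⁻¹ * (∑ i, T (s i) - n * P[T]))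
      ∂(Measure.pi fun _ => P)) atTop (𝓝 (∫ x, F₀ x ∂(gaussianReal 0 Var[T; P].toNNReal))) := by
  obtain ⟨Ω, mΩ, Q, Y, hYm, hYlaw, hYind, hQ⟩ := exists_iid ℕ P
  have hlaw0 : Q.map (Y 0) = P := (hYlaw 0).map_eq
  have hmean : Q[fun ω => T (Y 0 ω)] = P[T] := (hYlaw 0).integral_comp hT.aestronglyMeasurable
  have hvar : Var[fun ω => T (Y 0 ω); Q] = Var[T; P] := by
    rw [← hlaw0, variance_map hT.aemeasurable (hYm 0).aemeasurable]
    rfl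
  have hclt := tendstoInDistribution_inv_sqrt_mul_sum_sub (P := Q)
    (P' := gaussianReal 0 Var[fun ω => T (Y 0 ω); Q].toNNReal) (Y := id)
    (X := fun i ω => T (Y i ω)) HasLaw.id
    ((memLp_map_measure_iff (by rw [hlaw0]; exact hT.aestronglyMeasurable)
      (hYm 0).aemeasurable).1 (by rwa [hlaw0]))
    (hYind.comp (fun _ => T) fun _ => hT)
    (fun i => IdentDistrib.comp ⟨(hYm i).aemeasurable, (hYm 0).aemeasurable, by
      rw [(hYlaw i).map_eq, hlaw0]⟩ hT)
  have key := tendsto_integral_of_tendsto_of_continuous_convergence hclt.tendsto hF hF₀ hC hC₀ hlim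
  simp only [ProbabilityMeasure.coe_mk, Measure.map_id, hvar, hmean] at key
  refine key.congr fun n => ?_
  have hpi : Q.map (fun ω (i : Fin n) => Y i ω) = Measure.pi fun _ => P := by
    rw [(iIndepFun_iff_map_fun_eq_pi_map fun i => (hYm _).aemeasurable).1
      (hYind.precomp Fin.val_injective)]
    simp_rw [(hYlaw _).map_eq]
  have hY : Measurable fun ω (i : Fin n) => Y i ω := measurable_pi_iff.2 fun i => hYm i
  rw [← hpi, integral_map hY.aemeasurable, integral_map]
  · simp_rw [Finset.sum_range]
  · fun_prop
  · exact (hF n).aestronglyMeasurable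
  · exact ((hF n).comp (by fun_prop)).aestronglyMeasurable

theorem integral_exp_mul_sub_mul_sq {k J z : ℝ} (hJ : 0 < J) :
    ∫ u, Real.exp (k * u * z - J / 2 * u ^ 2) =
      √(2 * Real.pi / J) * Real.exp (k ^ 2 * z ^ 2 / (2 * J)) := by
  have h (u : ℝ) : Real.exp (k * u * z - J / 2 * u ^ 2) =
      Real.exp (-(J / 2) * (u - k * z / J) ^ 2) * Real.exp (k ^ 2 * z ^ 2 / (2 * J)) := by
    rw [← Real.exp_add]
    congr 1
    field_simp
    ring
  simp_rw [h]
  rw [integral_mul_const, integral_sub_right_eq_self (fun u => Real.exp (-(J / 2) * u ^ 2)),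
    integral_gaussian]
  congr 2
  field_simp

theorem laplace_exponent_rescale {θ₀ r : ℝ} (hr : r ≠ 0) (a b u z : ℝ) :
    r * (a * (θ₀ + u / r - θ₀)) * z - r ^ 2 * (b * (θ₀ + u / r - θ₀) ^ 2) =
      a * u * z - b * u ^ 2 := by
  field_simp
  ring

/-- The part of a Laplace integral away from the peak is negligible. -/
theorem tendsto_setIntegral_laplace_far {S : Set ℝ} (hS : MeasurableSet S) {g D w : ℝ → ℝ}
    (hg : Measurable g) (hD : Measurable D) (hwm : Measurable w)
    (hw0 : ∀ θ ∈ S, 0 ≤ w θ) (hw : IntegrableOn w S)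
    {m δ : ℝ} (hm : 0 < m) (hδ : 0 < δ) (hfar : ∀ θ ∈ S, δ ≤ |g θ| ∧ m * |g θ| ≤ D θ) (z : ℝ) :
    (∀ᶠ q : ℝ × ℝ in atTop ×ˢ 𝓝 z,
      IntegrableOn (fun θ => q.1 * Real.exp (q.1 * g θ * q.2 - q.1 ^ 2 * D θ) * w θ) S) ∧
    Tendsto (fun q : ℝ × ℝ => ∫ θ in S, q.1 * Real.exp (q.1 * g θ * q.2 - q.1 ^ 2 * D θ) * w θ)
      (atTop ×ˢ 𝓝 z) (𝓝 0) := by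
  have hdom : ∀ᶠ q : ℝ × ℝ in atTop ×ˢ 𝓝 z, ∀ᵐ θ ∂volume.restrict S,
      ‖q.1 * Real.exp (q.1 * g θ * q.2 - q.1 ^ 2 * D θ) * w θ‖ ≤
        q.1 * Real.exp (-(m * δ / 2) * q.1) * w θ := by
    have hz : ∀ᶠ y in 𝓝 z, |y| < |z| + 1 :=
      (continuous_abs.tendsto z).eventually_lt_const (by linarith)
    filter_upwards [(eventually_ge_atTop (max 1 (2 * (|z| + 1) / m))).prod_mk hz] with q hq
    obtain ⟨hr, hy⟩ := hq
    have hr1 : 1 ≤ q.1 := (le_max_left _ _).trans hr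
    have hr2 : 2 * (|z| + 1) ≤ q.1 * m := (div_le_iff₀ hm).1 ((le_max_right _ _).trans hr)
    refine (ae_restrict_iff' hS).2 (ae_of_all _ fun θ hθ => ?_)
    obtain ⟨h1, h2⟩ := hfar θ hθ
    rw [Real.norm_of_nonneg (mul_nonneg (by positivity) (hw0 θ hθ))]
    refine mul_le_mul_of_nonneg_right (mul_le_mul_of_nonneg_left (Real.exp_le_exp.2 ?_)
      (by linarith)) (hw0 θ hθ)
    have h3 : g θ * q.2 ≤ |g θ| * (q.1 * m / 2) := by
      calc g θ * q.2 ≤ |g θ| * |q.2| := by rw [← abs_mul]; exact le_abs_self _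
        _ ≤ _ := by gcongr; linarith
    have h4 : q.1 * (g θ * q.2) ≤ q.1 * (|g θ| * (q.1 * m / 2)) := by gcongr
    have h5 : q.1 ^ 2 * (m * |g θ|) ≤ q.1 ^ 2 * D θ := by gcongr
    have h6 : q.1 * (m / 2) * δ ≤ q.1 ^ 2 * (m / 2) * |g θ| := by
      gcongr
      nlinarith
    nlinarith
  refine ⟨?_, ?_⟩
  · filter_upwards [hdom] with q hq
    refine (hw.const_mul _).mono' ?_ hq
    exact ((((hg.const_mul _).mul_const _).sub (hD.const_mul _)).exp.const_mul _
      |>.mul hwm).aestronglyMeasurable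
  · have hlim : Tendsto (fun q : ℝ × ℝ => q.1 * Real.exp (-(m * δ / 2) * q.1) * ∫ θ in S, w θ)
        (atTop ×ˢ 𝓝 z) (𝓝 0) := by
      have h1 : Tendsto (fun r : ℝ => r * Real.exp (-(m * δ / 2) * r)) atTop (𝓝 0) := by
        have := tendsto_rpow_mul_exp_neg_mul_atTop_nhds_zero 1 (m * δ / 2) (by positivity)
        simpa using this
      simpa using (h1.comp (tendsto_fst (g := 𝓝 z))).mul_const (∫ θ in S, w θ)
    apply squeeze_zero_norm' _ hlim
    filter_upwards [hdom] with q hq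
    rw [← integral_const_mul]
    exact norm_integral_le_of_norm_le (hw.const_mul _) hq

/-- Laplace asymptotics on a small neighbourhood of the peak. -/
theorem tendsto_setIntegral_laplace_near {θ₀ k J : ℝ} (hJ : 0 < J) {s d w : ℝ → ℝ}
    {ε : ℝ} (hε : 0 < ε)
    (hg : Measurable fun θ => s θ * (θ - θ₀)) (hD : Measurable fun θ => d θ * (θ - θ₀) ^ 2)
    (hwm : Measurable w)
    (hs : ContinuousAt s θ₀) (hs₀ : s θ₀ = k) (hd : ContinuousAt d θ₀) (hd₀ : d θ₀ = J / 2)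
    (hw : ContinuousAt w θ₀) (hw₀ : w θ₀ = 1)
    (hbound : ∀ θ ∈ Metric.ball θ₀ ε, |s θ| ≤ |k| + 1 ∧ J / 4 ≤ d θ ∧ |w θ| ≤ 2) (z : ℝ) :
    Tendsto (fun q : ℝ × ℝ => ∫ θ in Metric.ball θ₀ ε,
        q.1 * Real.exp (q.1 * (s θ * (θ - θ₀)) * q.2 - q.1 ^ 2 * (d θ * (θ - θ₀) ^ 2)) * w θ)
      (atTop ×ˢ 𝓝 z) (𝓝 (√(2 * Real.pi / J) * Real.exp (k ^ 2 * z ^ 2 / (2 * J)))) := by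
  set f : ℝ × ℝ → ℝ → ℝ := fun q => (Metric.ball θ₀ ε).indicator fun θ =>
    Real.exp (q.1 * (s θ * (θ - θ₀)) * q.2 - q.1 ^ 2 * (d θ * (θ - θ₀) ^ 2)) * w θ with hf
  have hfm (q : ℝ × ℝ) : Measurable (f q) := by
    apply Measurable.indicator _ Metric.isOpen_ball.measurableSet
    exact (((hg.const_mul _).mul_const _).sub (hD.const_mul _)).exp.mul hwm
  have hsub : (fun q : ℝ × ℝ => ∫ u, f q (θ₀ + u / q.1)) =ᶠ[atTop ×ˢ 𝓝 z]
      fun q : ℝ × ℝ => ∫ θ in Metric.ball θ₀ ε,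
        q.1 * Real.exp (q.1 * (s θ * (θ - θ₀)) * q.2 - q.1 ^ 2 * (d θ * (θ - θ₀) ^ 2)) * w θ := by
    filter_upwards [(tendsto_fst (g := 𝓝 z)).eventually (eventually_gt_atTop (0 : ℝ))] with q hq
    rw [Measure.integral_comp_div (fun v => f q (θ₀ + v)) q.1,
      integral_add_left_eq_self (fun θ => f q θ) θ₀, hf,
      integral_indicator Metric.isOpen_ball.measurableSet, abs_of_pos hq, smul_eq_mul,
      ← integral_const_mul]
    simp_rw [mul_assoc]
  refine Tendsto.congr' hsub ?_
  rw [← integral_exp_mul_sub_mul_sq hJ]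
  set K := |z| + 1
  set L := |k| + 1
  have hL : 0 < L := by positivity
  have hK : 0 < K := by positivity
  apply tendsto_integral_filter_of_dominated_convergence
    (fun u => 2 * Real.exp (8 * (L * K) ^ 2 / J) * Real.exp (-(J / 8) * u ^ 2))
  · exact Eventually.of_forall fun q =>
      ((hfm q).comp (by fun_prop : Measurable fun u : ℝ => θ₀ + u / q.1)).aestronglyMeasurable
  · have hz : ∀ᶠ y in 𝓝 z, |y| < K :=
      (continuous_abs.tendsto z).eventually_lt_const (by simp [K])
    filter_upwards [(eventually_gt_atTop (0 : ℝ)).prod_mk hz] with q ⟨hr, hy⟩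
    refine ae_of_all _ fun u => ?_
    by_cases hu : θ₀ + u / q.1 ∈ Metric.ball θ₀ ε
    · obtain ⟨h1, h2, h3⟩ := hbound _ hu
      simp only [hf, indicator_of_mem hu, norm_mul, Real.norm_eq_abs, Real.abs_exp]
      rw [mul_comm, mul_assoc 2, ← Real.exp_add, laplace_exponent_rescale hr.ne']
      refine mul_le_mul h3 (Real.exp_le_exp.2 ?_) (Real.exp_pos _).le (by norm_num)
      have e2 : s (θ₀ + u / q.1) * u * q.2 ≤ L * K * |u| := by
        refine (le_abs_self _).trans ?_
        rw [mul_right_comm, abs_mul, abs_mul]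
        gcongr
      have e3 : J / 4 * u ^ 2 ≤ d (θ₀ + u / q.1) * u ^ 2 := by gcongr
      have e4 : L * K * |u| ≤ 8 * (L * K) ^ 2 / J + J / 8 * u ^ 2 := by
        rw [← sq_abs u, div_add' _ _ _ hJ.ne', le_div_iff₀ hJ]
        nlinarith [sq_nonneg (J * |u| - 8 * (L * K)), sq_nonneg (L * K), sq_nonneg (J * |u|)]
      linarith
    · simp only [hf, indicator_of_notMem hu, norm_zero]
      positivity
  · exact (integrable_exp_neg_mul_sq (by positivity)).const_mul _
  · refine ae_of_all _ fun u => ?_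
    have ht : Tendsto (fun q : ℝ × ℝ => θ₀ + u / q.1) (atTop ×ˢ 𝓝 z) (𝓝 θ₀) := by
      simpa using (((tendsto_const_nhds (x := u)).div_atTop tendsto_id).comp
        (tendsto_fst (g := 𝓝 z))).const_add θ₀
    have hs' := hs.tendsto.comp ht
    have hd' := hd.tendsto.comp ht
    have hw' := hw.tendsto.comp ht
    rw [hs₀] at hs'
    rw [hd₀] at hd'
    rw [hw₀] at hw'
    have hlim := (((hs'.mul_const u).mul (tendsto_snd (f := (atTop : Filter ℝ)) (g := 𝓝 z))).sub
      (hd'.mul_const (u ^ 2))).rexp.mul hw'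
    rw [mul_one] at hlim
    refine hlim.congr' ?_
    filter_upwards [(tendsto_fst (g := 𝓝 z)).eventually (eventually_gt_atTop (0 : ℝ)),
      ht.eventually (Metric.ball_mem_nhds θ₀ hε)] with q hq hu
    simp only [hf, indicator_of_mem (show θ₀ + u / q.1 ∈ Metric.ball θ₀ ε from hu),
      Function.comp, laplace_exponent_rescale hq.ne']

/-- Laplace asymptotics of `∫ r exp (r g(θ) y - r² D(θ)) w(θ) dθ`, jointly in `r → ∞` and
`y → z`. -/
theorem tendsto_setIntegral_laplace {Θ : Set ℝ} (hΘ : MeasurableSet Θ) {θ₀ k J : ℝ}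
    (hΘ₀ : Θ ∈ 𝓝 θ₀) (hJ : 0 < J) {s d w : ℝ → ℝ}
    (hg : Measurable fun θ => s θ * (θ - θ₀)) (hD : Measurable fun θ => d θ * (θ - θ₀) ^ 2)
    (hwm : Measurable w)
    (hs : ContinuousAt s θ₀) (hs₀ : s θ₀ = k) (hd : ContinuousAt d θ₀) (hd₀ : d θ₀ = J / 2)
    (hw : ContinuousAt w θ₀) (hw₀ : w θ₀ = 1)
    (hwnn : ∀ θ ∈ Θ, 0 ≤ w θ) (hwint : IntegrableOn w Θ)
    (hfar : ∀ ε > 0, ∃ m > 0, ∃ δ > 0, ∀ θ ∈ Θ, ε ≤ |θ - θ₀| →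
      δ ≤ |s θ * (θ - θ₀)| ∧ m * |s θ * (θ - θ₀)| ≤ d θ * (θ - θ₀) ^ 2) (z : ℝ) :
    Tendsto (fun q : ℝ × ℝ => ∫ θ in Θ,
        q.1 * Real.exp (q.1 * (s θ * (θ - θ₀)) * q.2 - q.1 ^ 2 * (d θ * (θ - θ₀) ^ 2)) * w θ)
      (atTop ×ˢ 𝓝 z) (𝓝 (√(2 * Real.pi / J) * Real.exp (k ^ 2 * z ^ 2 / (2 * J)))) := by
  have hev : ∀ᶠ θ in 𝓝 θ₀, θ ∈ Θ ∧ |s θ| ≤ |k| + 1 ∧ J / 4 ≤ d θ ∧ |w θ| ≤ 2 := by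
    refine Eventually.and hΘ₀ (Eventually.and ?_ (Eventually.and ?_ ?_))
    · exact (hs.abs.eventually_lt_const (by simp [hs₀])).mono fun _ h => h.le
    · exact (hd.eventually_const_lt (by rw [hd₀]; linarith)).mono fun _ h => h.le
    · exact (hw.abs.eventually_lt_const (by simp [hw₀])).mono fun _ h => h.le
  obtain ⟨ε, hε, hball⟩ := Metric.eventually_nhds_iff_ball.1 hev
  have hsubset : Metric.ball θ₀ ε ⊆ Θ := fun θ h => (hball θ h).1
  obtain ⟨m, hm, δ, hδ, hmδ⟩ := hfar ε hε
  have hnear := tendsto_setIntegral_laplace_near hJ hε hg hD hwm hs hs₀ hd hd₀ hw hw₀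
    (fun θ h => (hball θ h).2) z
  obtain ⟨hfarint, hfar'⟩ := tendsto_setIntegral_laplace_far
    (hΘ.diff Metric.isOpen_ball.measurableSet)
    (S := Θ \ Metric.ball θ₀ ε) (w := w) (g := fun θ => s θ * (θ - θ₀))
    (D := fun θ => d θ * (θ - θ₀) ^ 2) hg hD hwm (fun θ h => hwnn θ h.1)
    (hwint.mono_set sdiff_subset) hm hδ
    (fun θ h => hmδ θ h.1 (by simpa [Real.dist_eq] using h.2)) z
  have hsum := hnear.add hfar'
  rw [add_zero] at hsum
  refine hsum.congr' ?_
  filter_upwards [hfarint, hnear.eventually_ne (by positivity)] with q hq1 hq2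
  rw [← setIntegral_union disjoint_sdiff_right (hΘ.diff Metric.isOpen_ball.measurableSet)
    (Integrable.of_integral_ne_zero hq2) hq1, union_sdiff_cancel hsubset]

/-- A Laplace integral is bounded away from zero, uniformly in the linear perturbation. -/
theorem exists_setIntegral_laplace_inv_le {Θ : Set ℝ} (hΘ : MeasurableSet Θ) {θ₀ k J : ℝ}
    (hΘ₀ : Θ ∈ 𝓝 θ₀) (hk : 0 < k) (hJ : 0 < J) {s d w : ℝ → ℝ}
    (hs : ContinuousAt s θ₀) (hs₀ : s θ₀ = k) (hd : ContinuousAt d θ₀) (hd₀ : d θ₀ = J / 2)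
    (hw : ContinuousAt w θ₀) (hw₀ : w θ₀ = 1) (hwnn : ∀ θ ∈ Θ, 0 ≤ w θ) :
    ∀ᶠ r : ℝ in atTop, ∀ z : ℝ, |(∫ θ in Θ,
        r * Real.exp (r * (s θ * (θ - θ₀)) * z - r ^ 2 * (d θ * (θ - θ₀) ^ 2)) * w θ)⁻¹| ≤
      2 * Real.exp J := by
  have hev : ∀ᶠ θ in 𝓝 θ₀, θ ∈ Θ ∧ 0 ≤ s θ ∧ d θ ≤ J ∧ 1 / 2 ≤ w θ := by
    refine Eventually.and hΘ₀ (Eventually.and ?_ (Eventually.and ?_ ?_))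
    · exact (hs.eventually_const_lt (by rwa [hs₀])).mono fun _ h => h.le
    · exact (hd.eventually_lt_const (by rw [hd₀]; linarith)).mono fun _ h => h.le
    · exact (hw.eventually_const_lt (by rw [hw₀]; norm_num)).mono fun _ h => h.le
  obtain ⟨ε, hε, hball⟩ := Metric.eventually_nhds_iff_ball.1 hev
  filter_upwards [eventually_gt_atTop (1 / ε)] with r hr z
  have hr0 : 0 < r := lt_trans (by positivity) hr
  have hrε : 1 / r < ε := by rwa [one_div_lt hr0 hε]
  set f : ℝ → ℝ := fun θ =>
    r * Real.exp (r * (s θ * (θ - θ₀)) * z - r ^ 2 * (d θ * (θ - θ₀) ^ 2)) * w θ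
  by_cases hf_int : IntegrableOn f Θ
  swap
  · rw [integral_undef hf_int]
    simp only [inv_zero, abs_zero]
    positivity
  have hnn : ∀ θ ∈ Θ, 0 ≤ f θ := fun θ hθ => mul_nonneg (by positivity) (hwnn θ hθ)
  have key (a b : ℝ) (hab : b - a = 1 / r)
      (hmem : ∀ θ ∈ Icc a b, |θ - θ₀| ≤ 1 / r ∧ 0 ≤ (θ - θ₀) * z) :
      (2 * Real.exp J)⁻¹ ≤ ∫ θ in Θ, f θ := by
    have hsub : Icc a b ⊆ Metric.ball θ₀ ε := fun θ hθ => by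
      rw [Metric.mem_ball, Real.dist_eq]
      exact (hmem θ hθ).1.trans_lt hrε
    have hsubΘ : Icc a b ⊆ Θ := fun θ hθ => (hball θ (hsub hθ)).1
    calc (2 * Real.exp J)⁻¹ = ∫ _ in Icc a b, r * Real.exp (-J) * (1 / 2) := by
          rw [setIntegral_const, Real.volume_real_Icc, hab, max_eq_left (by positivity),
            smul_eq_mul, Real.exp_neg]
          field_simp
      _ ≤ ∫ θ in Icc a b, f θ := by
          apply setIntegral_mono_on continuousOn_const.integrableOn_Icc (hf_int.mono_set hsubΘ)
            measurableSet_Icc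
          intro θ hθ
          obtain ⟨_, h1, h2, h3⟩ := hball θ (hsub hθ)
          obtain ⟨h4, h5⟩ := hmem θ hθ
          have h6 : (r * (θ - θ₀)) ^ 2 ≤ 1 := by
            rw [sq_le_one_iff_abs_le_one, abs_mul, abs_of_pos hr0]
            calc r * |θ - θ₀| ≤ r * (1 / r) := by gcongr
              _ = 1 := by field_simp
          have h7 : 0 ≤ r * s θ * ((θ - θ₀) * z) := by positivity
          have h8 : d θ * (r * (θ - θ₀)) ^ 2 ≤ J := by
            calc d θ * (r * (θ - θ₀)) ^ 2 ≤ J * (r * (θ - θ₀)) ^ 2 := by gcongr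
              _ ≤ J * 1 := by gcongr
              _ = J := mul_one J
          simp only [f]
          gcongr
          nlinarith
      _ ≤ ∫ θ in Θ, f θ :=
          setIntegral_mono_set hf_int ((ae_restrict_iff' hΘ).2 (ae_of_all _ hnn))
            hsubΘ.eventuallyLE
  have hle : (2 * Real.exp J)⁻¹ ≤ ∫ θ in Θ, f θ := by
    have hr1 : 0 < 1 / r := by positivity
    rcases le_total 0 z with hz | hz
    · refine key θ₀ (θ₀ + 1 / r) (by ring) fun θ hθ => ⟨?_, ?_⟩
      · rw [abs_le]
        constructor <;> linarith [hθ.1, hθ.2]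
      · exact mul_nonneg (by linarith [hθ.1]) hz
    · refine key (θ₀ - 1 / r) θ₀ (by ring) fun θ hθ => ⟨?_, ?_⟩
      · rw [abs_le]
        constructor <;> linarith [hθ.1, hθ.2]
      · exact mul_nonneg_of_nonpos_of_nonpos (by linarith [hθ.2]) hz
  have hpos : 0 < ∫ θ in Θ, f θ := lt_of_lt_of_le (by positivity) hle
  rw [abs_of_pos (inv_pos.2 hpos)]
  exact inv_le_of_inv_le₀ (by positivity) hle

theorem moments_of_mgf_eq_exp_sub {X : Type*} [MeasurableSpace X] {P : Measure X}
    [IsProbabilityMeasure P] {T : X → ℝ} (hT : Measurable T) {A : ℝ → ℝ} {a : ℝ}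
    (hmgf : ∀ᶠ t in 𝓝 0, mgf T P t = Real.exp (A (a + t) - A a)) :
    MemLp T 2 P ∧ P[T] = deriv A a ∧ Var[T; P] = iteratedDeriv 2 A a := by
  have h0 : (0 : ℝ) ∈ interior (integrableExpSet T P) := by
    rw [mem_interior_iff_mem_nhds]
    filter_upwards [hmgf] with t ht
    by_contra hnot
    exact (Real.exp_pos _).ne' (ht.symm.trans (integral_undef hnot))
  have hcgf : cgf T P =ᶠ[𝓝 0] fun t => A (a + t) - A a := by
    filter_upwards [hmgf] with t ht
    rw [cgf, ht, Real.log_exp]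
  have hmean : P[T] = deriv A a := by
    have h1 := deriv_cgf_zero h0
    rw [hcgf.deriv_eq] at h1
    simpa [deriv_comp_const_add] using h1.symm
  refine ⟨by simpa using memLp_of_mem_interior_integrableExpSet h0 2, hmean, ?_⟩
  have h2 := iteratedDeriv_two_cgf_eq_integral h0
  have hd : deriv (cgf T P) 0 = P[T] := by simpa using deriv_cgf_zero h0
  rw [hcgf.iteratedDeriv_eq, hd] at h2
  rw [variance_eq_integral hT.aemeasurable]
  simp only [zero_mul, Real.exp_zero, mul_one, mgf_zero, div_one] at h2
  have h3 : deriv (fun t => A (a + t)) = fun t => deriv A (a + t) :=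
    funext fun t => deriv_comp_const_add ..
  rw [← h2]
  simp only [iteratedDeriv_succ, iteratedDeriv_zero, deriv_sub_const_fun, h3]
  rw [deriv_comp_const_add, add_zero]

/-- The remainder of the first order Taylor expansion of `A` at `a`. -/
noncomputable def taylorRemainder (A : ℝ → ℝ) (a y : ℝ) : ℝ := A (a + y) - A a - deriv A a * y

/-- The quotient of the first order Taylor remainder by `y ^ 2`, continuously extended. -/
noncomputable def taylorQuotient (A : ℝ → ℝ) (a y : ℝ) : ℝ :=
  if y = 0 then iteratedDeriv 2 A a / 2 else taylorRemainder A a y / y ^ 2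

theorem taylorQuotient_mul_sq (A : ℝ → ℝ) (a y : ℝ) :
    taylorQuotient A a y * y ^ 2 = taylorRemainder A a y := by
  by_cases hy : y = 0
  · simp [hy, taylorRemainder]
  · simp [taylorQuotient, hy]

theorem continuousAt_taylorQuotient {A : ℝ → ℝ} (hA : ContDiff ℝ 2 A) (a : ℝ) :
    ContinuousAt (taylorQuotient A a) 0 := by
  have h1 := taylor_tendsto convex_univ (mem_univ a) hA.contDiffOn
  rw [nhdsWithin_univ] at h1
  have h2 : Tendsto (fun y : ℝ => a + y) (𝓝 0) (𝓝 a) := by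
    simpa using (tendsto_id (α := ℝ) (x := 𝓝 0)).const_add a
  have h3 := (h1.comp h2).mono_left (nhdsWithin_le_nhds (s := {0}ᶜ))
  rw [continuousAt_iff_punctured_nhds]
  have h4 := h3.add_const (iteratedDeriv 2 A a / 2)
  rw [zero_add] at h4
  rw [show taylorQuotient A a 0 = iteratedDeriv 2 A a / 2 from if_pos rfl]
  refine h4.congr' ?_
  filter_upwards [self_mem_nhdsWithin] with y hy
  have hy : y ≠ 0 := hy
  simp only [Function.comp, taylorWithinEval_succ, taylor_within_zero_eval,
    iteratedDerivWithin_univ, add_sub_cancel_left, smul_eq_mul]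
  rw [taylorQuotient, if_neg hy, taylorRemainder]
  norm_num
  field_simp
  ring

theorem convexOn_taylorRemainder {A : ℝ → ℝ} (hA : ContDiff ℝ 2 A) {U : Set ℝ}
    (hU : Convex ℝ U) (hA'' : ∀ y ∈ U, 0 < iteratedDeriv 2 A y) (a : ℝ) :
    ConvexOn ℝ ((fun y => a + y) ⁻¹' U) (taylorRemainder A a) := by
  have h1 : ConvexOn ℝ U A := by
    refine convexOn_of_deriv2_nonneg hU hA.continuous.continuousOn
      (hA.differentiable (by simp)).differentiableOn ?_ fun y hy => ?_
    · have : ContDiff ℝ 1 (deriv A) := by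
        simpa using hA.iterate_deriv' 1 1
      exact (this.differentiable (by simp)).differentiableOn
    · rw [← iteratedDeriv_eq_iterate]
      exact (hA'' y (interior_subset hy)).le
  have h2 := h1.translate_right a
  have h3 : ConvexOn ℝ ((fun y => a + y) ⁻¹' U) fun y => -A a + -deriv A a * y :=
    ⟨h2.1, fun x _ y _ α β _ _ hαβ => le_of_eq <| by
      simp only [smul_eq_mul]
      linear_combination (A a) * hαβ⟩
  refine (h2.add h3).congr fun y _ => ?_
  simp only [taylorRemainder, Pi.add_apply, Function.comp]
  ring

theorem ConvexOn.exists_mul_abs_le {V : Set ℝ} {E φ : ℝ → ℝ} (hE : ConvexOn ℝ V E) (hV : 0 ∈ V)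
    (hφ : ContinuousAt φ 0) (hφ₀ : 0 < φ 0) (hEφ : ∀ y, φ y * y ^ 2 = E y)
    {δ : ℝ} (hδ : 0 < δ) : ∃ m > 0, ∀ y ∈ V, δ ≤ |y| → m * |y| ≤ E y := by
  obtain ⟨ε, hε, hball⟩ := Metric.eventually_nhds_iff_ball.1
    (hφ.eventually_const_lt (half_lt_self hφ₀))
  set ρ := min δ (ε / 2)
  have hρ : 0 < ρ := by positivity
  have hρε : ρ < ε := (min_le_right _ _).trans_lt (half_lt_self hε)
  refine ⟨φ 0 / 2 * ρ, by positivity, fun y hy hyδ => ?_⟩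
  have hρy : ρ ≤ |y| := (min_le_left _ _).trans hyδ
  have hy0 : 0 < |y| := hρ.trans_le hρy
  set t := ρ / |y|
  have ht1 : t ≤ 1 := (div_le_one hy0).2 hρy
  have ht0 : 0 < t := by positivity
  have hconv := hE.2 hV hy (sub_nonneg.2 ht1) ht0.le (by ring)
  have hE0 : E 0 = 0 := by simp [← hEφ]
  simp only [smul_eq_mul, mul_zero, zero_add, hE0] at hconv
  have habs : |t * y| = ρ := by
    rw [abs_mul, abs_of_pos ht0]
    exact div_mul_cancel₀ _ hy0.ne'
  have h1 := hball (t * y) (by rwa [Metric.mem_ball, dist_zero_right, Real.norm_eq_abs, habs])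
  have h2 : φ 0 / 2 * ρ ^ 2 ≤ E (t * y) := by
    rw [← hEφ, ← sq_abs (t * y), habs]
    gcongr
  have h3 : φ 0 / 2 * ρ ^ 2 ≤ ρ / |y| * E y := h2.trans hconv
  rw [div_mul_eq_mul_div ρ, le_div_iff₀ hy0] at h3
  have h4 : ρ * (φ 0 / 2 * ρ * |y|) ≤ ρ * E y := by linarith
  exact le_of_mul_le_mul_left h4 hρ

/-- A strictly monotone function stays away from its value at an interior point. -/
theorem StrictMonoOn.exists_le_abs_sub {Θ : Set ℝ} {η : ℝ → ℝ} (hη : StrictMonoOn η Θ) {θ₀ : ℝ}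
    (hΘ₀ : Θ ∈ 𝓝 θ₀) {ε : ℝ} (hε : 0 < ε) :
    ∃ δ > 0, ∀ θ ∈ Θ, ε ≤ |θ - θ₀| → δ ≤ |η θ - η θ₀| := by
  obtain ⟨r, hr, hball⟩ := Metric.nhds_basis_closedBall.mem_iff.1 hΘ₀
  set ρ := min r ε
  have hρ : 0 < ρ := lt_min hr hε
  have hmem {x : ℝ} (hx : |x - θ₀| ≤ ρ) : x ∈ Θ :=
    hball (by rw [Metric.mem_closedBall, Real.dist_eq]; exact hx.trans (min_le_left _ _))
  have h0 : θ₀ ∈ Θ := hmem (by simpa using hρ.le)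
  have h1 : θ₀ + ρ ∈ Θ := hmem (by simp [abs_of_pos hρ])
  have h2 : θ₀ - ρ ∈ Θ := hmem (by simp [abs_of_pos hρ])
  have h3 : η θ₀ < η (θ₀ + ρ) := hη h0 h1 (by linarith)
  have h4 : η (θ₀ - ρ) < η θ₀ := hη h2 h0 (by linarith)
  refine ⟨min (η (θ₀ + ρ) - η θ₀) (η θ₀ - η (θ₀ - ρ)), lt_min (by linarith) (by linarith),
    fun θ hθ hθε => ?_⟩
  rcases le_abs.1 ((min_le_right r ε).trans hθε) with h | h
  · have := hη.monotoneOn h1 hθ (by linarith)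
    exact (min_le_left _ _).trans ((by linarith : _ ≤ η θ - η θ₀).trans (le_abs_self _))
  · have := hη.monotoneOn hθ h2 (by linarith)
    exact (min_le_right _ _).trans ((by linarith : _ ≤ -(η θ - η θ₀)).trans (neg_le_abs _))

theorem StrictMonoOn.image_mem_nhds {Θ : Set ℝ} {η : ℝ → ℝ} (hη : StrictMonoOn η Θ)
    (hc : ContinuousOn η Θ) {θ₀ : ℝ} (hΘ₀ : Θ ∈ 𝓝 θ₀) : η '' Θ ∈ 𝓝 (η θ₀) := by
  obtain ⟨r, hr, hball⟩ := Metric.nhds_basis_closedBall.mem_iff.1 hΘ₀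
  rw [Real.closedBall_eq_Icc] at hball
  have h0 : θ₀ ∈ Θ := hball ⟨by linarith, by linarith⟩
  have h1 : θ₀ + r ∈ Θ := hball ⟨by linarith, le_rfl⟩
  have h2 : θ₀ - r ∈ Θ := hball ⟨le_rfl, by linarith⟩
  refine mem_of_superset (Icc_mem_nhds (hη h2 h0 (by linarith)) (hη h0 h1 (by linarith))) ?_
  exact (intermediate_value_Icc (by linarith) (hc.mono hball)).trans (image_mono hball)

theorem prod_expFamily_eq {X : Type*} {η A : ℝ → ℝ} {T B : X → ℝ} {p : ℝ → X → ℝ}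
    (hp : ∀ θ x, p θ x = Real.exp (η θ * T x - A (η θ) - B x))
    {n : ℕ} (hn : n ≠ 0) (θ₀ θ m : ℝ) (s : Fin n → X) :
    ∏ i, p θ (s i) = (∏ i, p θ₀ (s i)) * Real.exp (√n * (η θ - η θ₀) *
      ((√n)⁻¹ * (∑ i, T (s i) - n * m)) -
        √n ^ 2 * (A (η θ) - A (η θ₀) - m * (η θ - η θ₀))) := by
  have hn' : √(n : ℝ) ≠ 0 := by positivity
  simp_rw [hp, ← Real.exp_sum]
  rw [← Real.exp_add]
  congr 1
  rw [Real.sq_sqrt n.cast_nonneg]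
  simp only [Finset.sum_sub_distrib, ← Finset.mul_sum, Finset.sum_const, Finset.card_univ,
    Fintype.card_fin, nsmul_eq_mul]
  field_simp
  ring

section ExponentialFamily

variable {X : Type*} [MeasurableSpace X] {ν : Measure X} {η A : ℝ → ℝ} {T B : X → ℝ}
  {p : ℝ → X → ℝ}

theorem mgf_withDensity_expFamily (hT : Measurable T) (hB : Measurable B)
    (hp : ∀ θ x, p θ x = Real.exp (η θ * T x - A (η θ) - B x)) {θ₀ θ t : ℝ}
    (ht : η θ₀ + t = η θ) (hpint : ∫ x, p θ x ∂ν = 1) :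
    mgf T (ν.withDensity fun x => ENNReal.ofReal (p θ₀ x)) t =
      Real.exp (A (η θ₀ + t) - A (η θ₀)) := by
  have hm : Measurable (p θ₀) := by
    rw [show p θ₀ = _ from funext (hp θ₀)]
    fun_prop
  rw [mgf, integral_withDensity_eq_integral_toReal_smul hm.ennreal_ofReal (by simp)]
  have h (x : X) : (ENNReal.ofReal (p θ₀ x)).toReal • Real.exp (t * T x) =
      Real.exp (A (η θ₀ + t) - A (η θ₀)) * p θ x := by
    rw [ENNReal.toReal_ofReal (by rw [hp]; positivity), hp, hp, smul_eq_mul, ← Real.exp_add,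
      ← Real.exp_add, ← ht]
    congr 1
    ring
  simp_rw [h]
  rw [integral_const_mul, hpint, mul_one]

variable [SigmaFinite ν]

theorem expectedPosterior_self_eq (hT : Measurable T) (hB : Measurable B)
    (hp : ∀ θ x, p θ x = Real.exp (η θ * T x - A (η θ) - B x)) {Θ : Set ℝ} {π : ℝ → ℝ}
    {θ₀ : ℝ} (hpint : Integrable (p θ₀) ν) (hπ : π θ₀ ≠ 0) {n : ℕ} (hn : n ≠ 0) (m : ℝ) :
    expectedPosterior ν Θ π p θ₀ θ₀ n = √n * ∫ s : Fin n → X,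
      (∫ θ in Θ, √n * Real.exp (√n * (η θ - η θ₀) * ((√n)⁻¹ * (∑ i, T (s i) - n * m)) -
        √n ^ 2 * (A (η θ) - A (η θ₀) - m * (η θ - η θ₀))) * (π θ / π θ₀))⁻¹
      ∂(Measure.pi fun _ => ν.withDensity fun x => ENNReal.ofReal (p θ₀ x)) := by
  have hpos (x : X) : 0 < p θ₀ x := by rw [hp]; positivity
  have hm : Measurable (p θ₀) := by
    rw [show p θ₀ = _ from funext (hp θ₀)]
    fun_prop
  have hn' : √(n : ℝ) ≠ 0 := by positivity
  rw [pi_withDensity_ofReal (fun x => (hpos x).le) hpint,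
    integral_withDensity_eq_integral_toReal_smul (by fun_prop) (by simp), ← integral_const_mul,
    expectedPosterior]
  congr 1 with s
  have hs : 0 < ∏ i, p θ₀ (s i) := Finset.prod_pos fun i _ => hpos _
  rw [ENNReal.toReal_ofReal hs.le, smul_eq_mul]
  set e : ℝ → ℝ := fun θ => Real.exp (√n * (η θ - η θ₀) * ((√n)⁻¹ * (∑ i, T (s i) - n * m)) -
    √n ^ 2 * (A (η θ) - A (η θ₀) - m * (η θ - η θ₀)))
  have h1 : ∫ θ in Θ, (∏ i, p θ (s i)) * π θ =
      (∏ i, p θ₀ (s i)) * π θ₀ * ∫ θ in Θ, e θ * (π θ / π θ₀) := by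
    rw [← integral_const_mul]
    congr 1 with θ
    rw [prod_expFamily_eq hp hn θ₀ θ m s]
    change _ * e θ * _ = _
    field_simp
  have h2 : ∫ θ in Θ, √n * e θ * (π θ / π θ₀) = √n * ∫ θ in Θ, e θ * (π θ / π θ₀) := by
    simp_rw [mul_assoc]
    rw [integral_const_mul]
  rw [h1, h2, mul_inv]
  field_simp

end ExponentialFamily

theorem ContinuousOn.measurable_indicator {α : Type*} [TopologicalSpace α] [MeasurableSpace α]
    [BorelSpace α] {S : Set α} {f : α → ℝ} (hf : ContinuousOn f S) (hS : MeasurableSet S) :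
    Measurable (S.indicator f) := by
  classical
  rw [← piecewise_eq_indicator]
  exact hf.measurable_piecewise continuousOn_const hS

/-- The expected posterior at the true parameter grows like `√n`. -/
theorem tendsto_expectedPosterior_self_div_sqrt {X : Type*} [MeasurableSpace X] {ν : Measure X}
    [SigmaFinite ν] {Θ : Set ℝ} (hΘconv : Convex ℝ Θ) {η ηd : ℝ → ℝ}
    (hη : ∀ θ ∈ Θ, HasDerivWithinAt η (ηd θ) Θ θ) (hηd : ∀ θ ∈ Θ, 0 < ηd θ)
    {T B : X → ℝ} (hT : Measurable T) (hB : Measurable B) {A : ℝ → ℝ} (hA : ContDiff ℝ 2 A)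
    (hA'' : ∀ θ ∈ Θ, 0 < iteratedDeriv 2 A (η θ)) {p : ℝ → X → ℝ}
    (hp : ∀ θ x, p θ x = Real.exp (η θ * T x - A (η θ) - B x))
    (hpint : ∀ θ ∈ Θ, ∫ x, p θ x ∂ν = 1) {π : ℝ → ℝ} (hπc : ContinuousOn π Θ)
    (hπpos : ∀ θ ∈ Θ, 0 < π θ) (hπint : ∫ θ in Θ, π θ = 1) {θ₀ : ℝ} (hθ₀ : θ₀ ∈ interior Θ) :
    Tendsto (fun n : ℕ => expectedPosterior ν Θ π p θ₀ θ₀ n / √n) atTop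
      (𝓝 ((√(2 * Real.pi / (iteratedDeriv 2 A (η θ₀) * ηd θ₀ ^ 2)))⁻¹ * (√2)⁻¹)) := by
  have hΘ₀ : Θ ∈ 𝓝 θ₀ := mem_interior_iff_mem_nhds.1 hθ₀
  have hθ₀' : θ₀ ∈ Θ := interior_subset hθ₀
  have hΘ : MeasurableSet Θ := hΘconv.ordConnected.measurableSet
  set a := η θ₀
  set k := ηd θ₀
  set v := iteratedDeriv 2 A a
  have hk : 0 < k := hηd θ₀ hθ₀'
  have hv : 0 < v := hA'' θ₀ hθ₀'
  set J := v * k ^ 2 with hJdef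
  have hJ : 0 < J := by positivity
  have hηc : ContinuousOn η Θ := fun θ hθ => (hη θ hθ).continuousWithinAt
  have hmono : StrictMonoOn η Θ := strictMonoOn_of_deriv_pos hΘconv hηc fun θ hθ => by
    rw [((hη θ (interior_subset hθ)).hasDerivAt (mem_interior_iff_mem_nhds.1 hθ)).deriv]
    exact hηd θ (interior_subset hθ)
  have himage : η '' Θ ∈ 𝓝 a := hmono.image_mem_nhds hηc hΘ₀
  have hconv : Convex ℝ (η '' Θ) :=
    Real.convex_iff_isPreconnected.2 (hΘconv.isPreconnected.image η hηc)
  -- the distribution of a single observation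
  have hpi : Integrable (p θ₀) ν := Integrable.of_integral_ne_zero (by simp [hpint θ₀ hθ₀'])
  have hp0 (x : X) : 0 ≤ p θ₀ x := by rw [hp]; positivity
  set P := ν.withDensity fun x => ENNReal.ofReal (p θ₀ x)
  have hPprob : IsProbabilityMeasure P := ⟨by
    rw [withDensity_apply _ .univ, setLIntegral_univ, ← ofReal_integral_eq_lintegral_ofReal hpi
      (ae_of_all _ hp0), hpint θ₀ hθ₀', ENNReal.ofReal_one]⟩
  obtain ⟨hT2, hmean, hvar⟩ := moments_of_mgf_eq_exp_sub (P := P) hT (A := A) (a := a) <| by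
    have : Tendsto (fun t : ℝ => a + t) (𝓝 0) (𝓝 a) := by
      simpa using (tendsto_id (α := ℝ) (x := 𝓝 0)).const_add a
    filter_upwards [this himage] with t ⟨θ, hθ, ht⟩
    exact mgf_withDensity_expFamily hT hB hp ht.symm (hpint θ hθ)
  -- the ingredients of the Laplace integral
  set g : ℝ → ℝ := Θ.indicator fun θ => η θ - a
  set s := dslope g θ₀ with hsdef
  set d : ℝ → ℝ := fun θ => taylorQuotient A a (g θ) * s θ ^ 2 with hddef
  set w : ℝ → ℝ := Θ.indicator fun θ => π θ / π θ₀
  have hgΘ {θ : ℝ} (hθ : θ ∈ Θ) : g θ = η θ - a := indicator_of_mem hθ _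
  have hwΘ {θ : ℝ} (hθ : θ ∈ Θ) : w θ = π θ / π θ₀ := indicator_of_mem hθ _
  have hg₀ : g θ₀ = 0 := by rw [hgΘ hθ₀', sub_self]
  have hgd : HasDerivAt g k θ₀ :=
    (((hη θ₀ hθ₀').hasDerivAt hΘ₀).sub_const a).congr_of_eventuallyEq <|
      mem_of_superset hΘ₀ fun θ hθ => hgΘ hθ
  have hsg (θ : ℝ) : s θ * (θ - θ₀) = g θ := by
    have := sub_smul_dslope g θ₀ θ
    rwa [hg₀, sub_zero, smul_eq_mul, mul_comm] at this
  have hdg (θ : ℝ) : d θ * (θ - θ₀) ^ 2 = taylorRemainder A a (g θ) := by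
    rw [← taylorQuotient_mul_sq, hddef, mul_assoc, ← mul_pow, hsg]
  have hs₀ : s θ₀ = k := by rw [hsdef, dslope_same, hgd.deriv]
  have hs : ContinuousAt s θ₀ := continuousAt_dslope_same.2 hgd.differentiableAt
  have hd₀ : d θ₀ = J / 2 := by
    simp only [hddef, hs₀, hg₀, taylorQuotient, if_true]
    ring
  have hφ : ContinuousAt (taylorQuotient A a) (g θ₀) := by
    rw [hg₀]
    exact continuousAt_taylorQuotient hA a
  have hd : ContinuousAt d θ₀ := (hφ.comp hgd.continuousAt).mul (hs.pow 2)
  have hgm : Measurable g := (hηc.sub continuousOn_const).measurable_indicator hΘ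
  have hDm : Measurable fun θ => taylorRemainder A a (g θ) := by
    have := hA.continuous.measurable
    unfold taylorRemainder
    fun_prop
  have hwm : Measurable w := (hπc.div_const _).measurable_indicator hΘ
  have hw₀ : w θ₀ = 1 := by rw [hwΘ hθ₀', div_self (hπpos θ₀ hθ₀').ne']
  have hw : ContinuousAt w θ₀ := ((hπc.continuousAt hΘ₀).div_const _).congr <|
    mem_of_superset hΘ₀ fun θ hθ => (hwΘ hθ).symm
  have hwnn (θ : ℝ) (hθ : θ ∈ Θ) : 0 ≤ w θ := by
    rw [hwΘ hθ]
    exact (div_pos (hπpos θ hθ) (hπpos θ₀ hθ₀')).le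
  have hwint : IntegrableOn w Θ := by
    have : IntegrableOn π Θ := Integrable.of_integral_ne_zero (by simp [hπint])
    exact IntegrableOn.congr_fun (this.div_const (π θ₀)) (fun θ hθ => (hwΘ hθ).symm) hΘ
  have hfar (ε : ℝ) (hε : ε > 0) : ∃ m > 0, ∃ δ > 0, ∀ θ ∈ Θ, ε ≤ |θ - θ₀| →
      δ ≤ |s θ * (θ - θ₀)| ∧ m * |s θ * (θ - θ₀)| ≤ d θ * (θ - θ₀) ^ 2 := by
    obtain ⟨δ, hδ, hδle⟩ := hmono.exists_le_abs_sub hΘ₀ hε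
    obtain ⟨m, hm, hmle⟩ := (convexOn_taylorRemainder hA hconv
      (by rintro _ ⟨θ, hθ, rfl⟩; exact hA'' θ hθ) a).exists_mul_abs_le
      (by simpa using mem_of_mem_nhds himage) (continuousAt_taylorQuotient hA a)
      (by simp only [taylorQuotient, if_true]; positivity) (taylorQuotient_mul_sq A a) hδ
    refine ⟨m, hm, δ, hδ, fun θ hθ hθε => ?_⟩
    have h := hδle θ hθ hθε
    rw [hsg, hdg, hgΘ hθ]
    exact ⟨h, hmle _ ⟨θ, hθ, by ring⟩ h⟩
  -- the limit of the rescaled inverse posterior normalization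
  set F : ℕ → ℝ → ℝ := fun n z => (∫ θ in Θ, √n * Real.exp (√n * (s θ * (θ - θ₀)) * z -
    √n ^ 2 * (d θ * (θ - θ₀) ^ 2)) * w θ)⁻¹ with hF
  set F₀ : ℝ → ℝ := fun z =>
    (√(2 * Real.pi / J) * Real.exp (k ^ 2 * z ^ 2 / (2 * J)))⁻¹ with hF₀
  have hF₀' (z : ℝ) : F₀ z = (√(2 * Real.pi / J))⁻¹ * Real.exp (-(z ^ 2 / (2 * v))) := by
    simp only [hF₀]
    rw [mul_inv, Real.exp_neg, hJdef]
    congr 3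
    field_simp
  have hsqrt : Tendsto (fun n : ℕ => √(n : ℝ)) atTop atTop :=
    Real.tendsto_sqrt_atTop.comp tendsto_natCast_atTop_atTop
  have hlim := tendsto_integral_pi_of_continuous_convergence P hT hT2 (F := F) (F₀ := F₀)
    (C := max (2 * Real.exp J) (√(2 * Real.pi / J))⁻¹) ?_ ?_ ?_ ?_ ?_
  rotate_left
  · intro n
    refine (StronglyMeasurable.integral_prod_right' (f := fun q : ℝ × ℝ => √n * Real.exp
      (√n * (s q.2 * (q.2 - θ₀)) * q.1 - √n ^ 2 * (d q.2 * (q.2 - θ₀) ^ 2)) * w q.2)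
      (Measurable.stronglyMeasurable ?_)).measurable.inv
    simp_rw [hsg, hdg]
    have := hDm.comp (measurable_snd : Measurable (Prod.snd : ℝ × ℝ → ℝ))
    fun_prop
  · simp_rw [funext hF₀']
    fun_prop
  · filter_upwards [hsqrt.eventually
      (exists_setIntegral_laplace_inv_le hΘ hΘ₀ hk hJ hs hs₀ hd hd₀ hw hw₀ hwnn)] with n hn z
    exact (hn z).trans (le_max_left _ _)
  · intro z
    rw [hF₀', abs_of_nonneg (by positivity)]
    refine le_max_of_le_right (mul_le_of_le_one_right (by positivity) (Real.exp_le_one_iff.2 ?_))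
    exact neg_nonpos.2 (by positivity)
  · intro z
    refine Tendsto.inv₀ ?_ (by positivity)
    exact (tendsto_setIntegral_laplace hΘ hΘ₀ hJ (by simpa only [hsg]) (by simpa only [hdg]) hwm hs
      hs₀ hd hd₀ hw hw₀ hwnn hwint hfar z).comp ((hsqrt.comp tendsto_fst).prodMk tendsto_snd)
  simp_rw [hF₀'] at hlim
  rw [hvar, integral_const_mul, integral_gaussianReal_exp_neg_sq_div hv] at hlim
  refine hlim.congr' ?_
  filter_upwards [eventually_ne_atTop 0] with n hn
  have hn' : √(n : ℝ) ≠ 0 := by positivity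
  rw [expectedPosterior_self_eq hT hB hp hpi (hπpos θ₀ hθ₀').ne' hn (deriv A a),
    mul_div_cancel_left₀ _ hn', hmean]
  congr 1 with x
  rw [hF]
  refine congrArg _ (setIntegral_congr_fun hΘ fun θ hθ => ?_)
  simp only [hsg, hdg, hgΘ hθ, hwΘ hθ, taylorRemainder, add_sub_cancel, a]

end

/-- One-dimensional exponential family setup.  For `θ₀` an interior point
of `Θ`, with Fisher information `I₀ = A''(η θ₀) (η' θ₀)²`, the expected posterior
`E_{θ₀}[q_n^{θ₀}] = ψ_{θ₀,θ₀}(n)` is asymptotically equivalent to `(√I₀ / (2√π)) √n` as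
`n → ∞`. -/
theorem exponential_family_asymptotics_same_parameter
    {X : Type*} [MeasurableSpace X] (ν : Measure X) [SigmaFinite ν]
    (Θ : Set ℝ) (hΘconv : Convex ℝ Θ) (hΘnontriv : ∃ a ∈ Θ, ∃ b ∈ Θ, a ≠ b)
    (η ηd : ℝ → ℝ)
    (hη : ∀ θ ∈ Θ, HasDerivWithinAt η (ηd θ) Θ θ)
    (hηd : ∀ θ ∈ Θ, 0 < ηd θ)
    (T B : X → ℝ) (hT : Measurable T) (hB : Measurable B)
    (A : ℝ → ℝ) (hA : ContDiff ℝ 2 A)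
    (hA'' : ∀ θ ∈ Θ, 0 < iteratedDeriv 2 A (η θ))
    (p : ℝ → X → ℝ)
    (hp : ∀ θ x, p θ x = Real.exp (η θ * T x - A (η θ) - B x))
    (hpint : ∀ θ ∈ Θ, ∫ x, p θ x ∂ν = 1)
    (π : ℝ → ℝ) (hπc : ContinuousOn π Θ) (hπpos : ∀ θ ∈ Θ, 0 < π θ)
    (hπint : ∫ θ in Θ, π θ = 1)
    (θ₀ : ℝ) (hθ₀ : θ₀ ∈ interior Θ)
    (I₀ : ℝ) (hI₀ : I₀ = iteratedDeriv 2 A (η θ₀) * (ηd θ₀) ^ 2) :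
    Filter.Tendsto
      (fun n : ℕ =>
        expectedPosterior ν Θ π p θ₀ θ₀ n * (2 * Real.sqrt Real.pi) /
          (Real.sqrt I₀ * Real.sqrt n))
      Filter.atTop (nhds 1) := by
  have hI : 0 < I₀ := by
    have h1 := hA'' θ₀ (interior_subset hθ₀)
    have h2 := hηd θ₀ (interior_subset hθ₀)
    rw [hI₀]
    positivity
  have h := (tendsto_expectedPosterior_self_div_sqrt hΘconv hη hηd hT hB hA hA'' hp hpint hπc
    hπpos hπint hθ₀).mul_const (2 * Real.sqrt Real.pi / Real.sqrt I₀)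
  rw [← hI₀] at h
  have hlim : (Real.sqrt (2 * Real.pi / I₀))⁻¹ * (Real.sqrt 2)⁻¹ *
      (2 * Real.sqrt Real.pi / Real.sqrt I₀) = 1 := by
    have h1 : Real.sqrt I₀ ≠ 0 := by positivity
    have h2 : Real.sqrt Real.pi ≠ 0 := (Real.sqrt_pos.2 Real.pi_pos).ne'
    rw [Real.sqrt_div (by positivity), Real.sqrt_mul zero_le_two]
    field_simp
    exact (Real.sq_sqrt zero_le_two).symm
  rw [hlim] at h
  refine h.congr fun n => ?_
  rw [div_mul_div_comm, mul_comm (Real.sqrt n)]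
end
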